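/- arXiv:2207.06212 — 8 statements merged into one kernel-verified Lean document; each statement's English description precedes it below -/
import Mathlib

section
/- For every positive integer n and every real number x, 2^n · Â_n(x) = ∑_{σ ∈ S_n} (1+x)^{dda(σ)} · 2^{val(σ)} · (1+x^2)^{pk(σ)}, where the sum is over all permutations σ of {1,...,n} with the boundary convention σ(0) = σ(n+1) = n+1. -/
open Finset

/-- The word of a permutation of `{1,...,n}` with boundary convention `σ(0) = σ(n+1) = n+1`. -/
def extA (n : ℕ) (σ : Equiv.Perm (Fin n)) : ℕ → ℕ := fun i =>
  if h : 1 ≤ i ∧ i ≤ n then (σ ⟨i - 1, by omega⟩ : ℕ) + 1 else n + 1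

/-- The word of a permutation of `{1,...,n}` with boundary convention `σ(0) = 0`, `σ(n+1) = n+1`. -/
def ext0 (n : ℕ) (σ : Equiv.Perm (Fin n)) : ℕ → ℕ := fun i =>
  if h : 1 ≤ i ∧ i ≤ n then (σ ⟨i - 1, by omega⟩ : ℕ) + 1
  else if i = 0 then 0 else n + 1

/-- Number of double ascents (indices `i ∈ {1,...,n}` with `w(i-1) < w(i) < w(i+1)`). -/
def daCount (n : ℕ) (w : ℕ → ℕ) : ℕ :=
  ((Icc 1 n).filter fun i => w (i - 1) < w i ∧ w i < w (i + 1)).card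

/-- Number of double descents (indices `i ∈ {1,...,n}` with `w(i-1) > w(i) > w(i+1)`). -/
def ddCount (n : ℕ) (w : ℕ → ℕ) : ℕ :=
  ((Icc 1 n).filter fun i => w i < w (i - 1) ∧ w (i + 1) < w i).card

/-- Number of valleys (indices `i ∈ {1,...,n}` with `w(i-1) > w(i) < w(i+1)`). -/
def valCount (n : ℕ) (w : ℕ → ℕ) : ℕ :=
  ((Icc 1 n).filter fun i => w i < w (i - 1) ∧ w i < w (i + 1)).card

/-- Number of peaks (indices `i ∈ {1,...,n}` with `w(i-1) < w(i) > w(i+1)`). -/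
def pkCount (n : ℕ) (w : ℕ → ℕ) : ℕ :=
  ((Icc 1 n).filter fun i => w (i - 1) < w i ∧ w (i + 1) < w i).card

/-- `dda = da + dd`. -/
def ddaCount (n : ℕ) (w : ℕ → ℕ) : ℕ := daCount n w + ddCount n w

/-- Number of alternating descents of a permutation of `{1,...,n}`:
indices `i ∈ {1,...,n-1}` with `σ(i) > σ(i+1)` and `i` odd, or `σ(i) < σ(i+1)` and `i` even. -/
def altDesA (n : ℕ) (σ : Equiv.Perm (Fin n)) : ℕ :=
  ((Ico 1 n).filter fun i =>
    (Odd i ∧ extA n σ (i + 1) < extA n σ i) ∨ (Even i ∧ extA n σ i < extA n σ (i + 1))).card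

/-- The alternating Eulerian polynomial `Â_n(x)`. -/
noncomputable def hatA (n : ℕ) (x : ℝ) : ℝ := ∑ σ : Equiv.Perm (Fin n), x ^ altDesA n σ

/-- The signed word of a type B permutation encoded as a pair `(σ, ε)` of a permutation of
`{1,...,n}` and a sign vector; position `0` (and positions `> n`) carry the value `0`. -/
def wordB (n : ℕ) (σ : Equiv.Perm (Fin n)) (ε : Fin n → Bool) : ℕ → ℤ := fun i =>
  if h : 1 ≤ i ∧ i ≤ n then
    (if ε ⟨i - 1, by omega⟩ then ((σ ⟨i - 1, by omega⟩ : ℕ) + 1 : ℤ)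
     else -((σ ⟨i - 1, by omega⟩ : ℕ) + 1 : ℤ))
  else 0

/-- `i` is an alternating descent position of the word `w`:
either `i` is even and `w(i) < w(i+1)`, or `i` is odd and `w(i) > w(i+1)`. -/
def isAltDesZ (w : ℕ → ℤ) (i : ℕ) : Prop :=
  (Even i ∧ w i < w (i + 1)) ∨ (Odd i ∧ w (i + 1) < w i)

instance (w : ℕ → ℤ) : DecidablePred (isAltDesZ w) := fun i => by
  unfold isAltDesZ; infer_instance

/-- `d̂_B`: number of type B alternating descent positions `i ∈ {0,1,...,n-1}`. -/
def altDesB (n : ℕ) (σ : Equiv.Perm (Fin n)) (ε : Fin n → Bool) : ℕ :=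
  ((range n).filter (isAltDesZ (wordB n σ ε))).card

/-- The type B alternating Eulerian polynomial `B̂_n(x)`. -/
noncomputable def hatB (n : ℕ) (x : ℝ) : ℝ :=
  ∑ p : Equiv.Perm (Fin n) × (Fin n → Bool), x ^ altDesB n p.1 p.2

/-- `d̂`: number of alternating descent positions `i ∈ {1,...,n-1}` of a signed word
(position `0` excluded). -/
def altDesWord (n : ℕ) (w : ℕ → ℤ) : ℕ := ((Ico 1 n).filter (isAltDesZ w)).card

/-- Derivative polynomials of the tangent function: `P₀ = X`, `P_{n+1} = (1+X²)·Pₙ'`. -/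
noncomputable def tanP : ℕ → Polynomial ℝ
  | 0 => Polynomial.X
  | n + 1 => (1 + Polynomial.X ^ 2) * Polynomial.derivative (tanP n)

/-- Derivative polynomials of the secant function: `Q₀ = 1`, `Q_{n+1} = X·Qₙ + (1+X²)·Qₙ'`. -/
noncomputable def secQ : ℕ → Polynomial ℝ
  | 0 => 1
  | n + 1 => Polynomial.X * secQ n + (1 + Polynomial.X ^ 2) * Polynomial.derivative (secQ n)

/-- The word of `(σ, ε)` is down-up alternating: `π(1) > π(2) < π(3) > π(4) ⋯`. -/
def isDownUpB (m : ℕ) (σ : Equiv.Perm (Fin m)) (ε : Fin m → Bool) : Prop :=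
  ∀ i ∈ Ico 1 m,
    (Odd i → wordB m σ ε (i + 1) < wordB m σ ε i) ∧
    (Even i → wordB m σ ε i < wordB m σ ε (i + 1))

instance (m : ℕ) (σ : Equiv.Perm (Fin m)) (ε : Fin m → Bool) : Decidable (isDownUpB m σ ε) := by
  unfold isDownUpB; infer_instance

/-- `DU_m^{(B)}`: the number of down-up alternating type B permutations of length `m`. -/
def duBCount (m : ℕ) : ℕ :=
  (Finset.univ.filter fun p : Equiv.Perm (Fin m) × (Fin m → Bool) =>
    isDownUpB m p.1 p.2).card

/-- `S_m`: the number of snakes of length `m` (down-up alternating type B permutations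
whose first entry is positive). -/
def snakeCount (m : ℕ) : ℕ :=
  (Finset.univ.filter fun p : Equiv.Perm (Fin m) × (Fin m → Bool) =>
    0 < wordB m p.1 p.2 1 ∧ isDownUpB m p.1 p.2).card

/-- `B̂_n^-(x)`: sum over type B permutations with negative first entry. -/
noncomputable def hatBminus (n : ℕ) (x : ℝ) : ℝ :=
  ∑ p ∈ Finset.univ.filter
      (fun p : Equiv.Perm (Fin n) × (Fin n → Bool) => wordB n p.1 p.2 1 < 0),
    x ^ altDesB n p.1 p.2

/-- `B̂_n^+(x)`: sum over type B permutations with positive first entry. -/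
noncomputable def hatBplus (n : ℕ) (x : ℝ) : ℝ :=
  ∑ p ∈ Finset.univ.filter
      (fun p : Equiv.Perm (Fin n) × (Fin n → Bool) => 0 < wordB n p.1 p.2 1),
    x ^ altDesB n p.1 p.2

/-- The product over consecutive entries of a word of `x` for each alternating descent, where
descents count at the first position iff `p` is true, and the parity flips at each step. -/
noncomputable def altDesWeight {α : Type*} [LinearOrder α] (x : ℝ) : Bool → List α → ℝ
  | _, [] => 1
  | _, [_] => 1
  | p, a :: b :: t =>
    (if p = decide (b < a) then x else 1) * altDesWeight x (!p) (b :: t)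

/-- The weight of an entry, given whether it exceeds its left neighbour and whether it is
exceeded by its right neighbour. -/
noncomputable def entryWeight (x : ℝ) : Bool → Bool → ℝ
  | true, true => 1 + x
  | false, false => 1 + x
  | false, true => 2
  | true, false => 1 + x ^ 2

/-- The product of the entry weights of a word followed by `∞`, where `up` tells whether the
first entry exceeds its left neighbour. -/
noncomputable def shapeWeight {α : Type*} [LinearOrder α] (x : ℝ) : Bool → List α → ℝ
  | _, [] => 1
  | up, [_] => entryWeight x up true
  | up, a :: b :: t =>
    entryWeight x up (decide (a < b)) * shapeWeight x (decide (a < b)) (b :: t)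

section Words

variable {α : Type*} [LinearOrder α] (x : ℝ)

theorem altDesWeight_append_cons_max (p : Bool) (l₁ l₂ : List α) (m : α)
    (h₁ : ∀ a ∈ l₁, a < m) (h₂ : ∀ a ∈ l₂, a < m) :
    altDesWeight x p (l₁ ++ m :: l₂) =
      (if p ^^ l₁.length.bodd then x else 1) ^
        ((if l₁.length = 0 then 0 else 1) + if l₂.length = 0 then 0 else 1) *
        (altDesWeight x p l₁ * altDesWeight x (!(p ^^ l₁.length.bodd)) l₂) := by
  induction l₁ generalizing p with
  | nil =>
    cases l₂ with
    | nil => simp [altDesWeight]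
    | cons b t =>
      have : b < m := h₂ b (by simp)
      simp [altDesWeight, this]
  | cons a t ih =>
    have ha : a < m := h₁ a (by simp)
    have ih := ih (!p) fun b hb => h₁ b (by simp [hb])
    cases t with
    | nil =>
      simp only [List.nil_append] at ih
      simp only [List.cons_append, List.nil_append, altDesWeight, ih]
      cases p <;> simp [ha.le, pow_add, mul_assoc]
    | cons b t =>
      simp only [List.cons_append] at ih
      simp only [List.cons_append, altDesWeight, ih]
      rw [mul_left_comm, mul_assoc (if p = _ then _ else _)]
      cases p <;> simp [Nat.bodd_succ]

theorem shapeWeight_cons_max (up : Bool) (l : List α) (m : α) (h : ∀ a ∈ l, a < m) :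
    shapeWeight x up (m :: l) =
      entryWeight x up (decide (l.length = 0)) * shapeWeight x false l := by
  cases l with
  | nil => simp [shapeWeight]
  | cons b t =>
    have : b < m := h b (by simp)
    simp [shapeWeight, this.not_gt]

theorem shapeWeight_append_cons_max (up : Bool) (l₁ l₂ : List α) (m : α) (hl : l₁ ≠ [])
    (h₁ : ∀ a ∈ l₁, a < m) :
    shapeWeight x up (l₁ ++ m :: l₂) =
      shapeWeight x up l₁ * shapeWeight x true (m :: l₂) := by
  induction l₁ generalizing up with
  | nil => exact absurd rfl hl
  | cons a t ih =>
    have ha : a < m := h₁ a (by simp)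
    cases t with
    | nil => simp [shapeWeight, ha]
    | cons b t =>
      have ih := ih (decide (a < b)) (by simp) fun b hb => h₁ b (by simp [hb])
      simp only [List.cons_append] at ih
      simp only [List.cons_append, shapeWeight, ih, mul_assoc]

theorem shapeWeight_false_append_cons_max (l₁ l₂ : List α) (m : α)
    (h₁ : ∀ a ∈ l₁, a < m) (h₂ : ∀ a ∈ l₂, a < m) :
    shapeWeight x false (l₁ ++ m :: l₂) =
      (x ^ ((if l₁.length = 0 then 0 else 1) + if l₂.length = 0 then 0 else 1) + 1) *
        (shapeWeight x false l₁ * shapeWeight x false l₂) := by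
  rcases eq_or_ne l₁ [] with rfl | hl
  · rw [List.nil_append, shapeWeight_cons_max x _ _ _ h₂]
    cases l₂ <;> simp [entryWeight, shapeWeight, add_comm, one_add_one_eq_two]
  · rw [shapeWeight_append_cons_max x _ _ _ _ hl h₁, shapeWeight_cons_max x _ _ _ h₂]
    cases l₁ with
    | nil => exact absurd rfl hl
    | cons a t => cases l₂ <;> simp [entryWeight] <;> ring

/-- The words using each letter of `S` exactly once. -/
def words (S : Finset α) : Finset (List α) := S.val.lists.toFinset

theorem mem_words_iff_coe_eq {S : Finset α} {l : List α} :
    l ∈ words S ↔ (l : Multiset α) = S.val := by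
  rw [words, Multiset.mem_toFinset, Multiset.mem_lists_iff, eq_comm]
  rfl

theorem mem_words_iff {S : Finset α} {l : List α} :
    l ∈ words S ↔ l.Nodup ∧ ∀ a, a ∈ l ↔ a ∈ S := by
  rw [mem_words_iff_coe_eq]
  constructor
  · intro h
    refine ⟨?_, fun a => ?_⟩
    · rw [← Multiset.coe_nodup, h]; exact S.nodup
    · rw [← Finset.mem_val, ← h, Multiset.mem_coe]
  · rintro ⟨hn, h⟩
    rw [Multiset.Nodup.ext (Multiset.coe_nodup.2 hn) S.nodup]
    simp [h]

theorem length_of_mem_words {S : Finset α} {l : List α} (h : l ∈ words S) :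
    l.length = S.card := by
  rw [Finset.card_def, ← mem_words_iff_coe_eq.1 h, Multiset.coe_card]

/-- Words on `insert m T` are split by the letter `m`. -/
theorem sum_words_insert (T : Finset α) (m : α) (hm : m ∉ T) (g : List α → ℝ) :
    ∑ l ∈ words (insert m T), g l =
      ∑ A ∈ T.powerset, ∑ l₁ ∈ words A, ∑ l₂ ∈ words (T \ A), g (l₁ ++ m :: l₂) := by
  simp only [← Finset.sum_product']
  rw [Finset.sum_sigma']
  symm
  refine Finset.sum_nbij (fun p => p.2.1 ++ m :: p.2.2) ?_ ?_ ?_ fun _ _ => rfl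
  · rintro ⟨A, l₁, l₂⟩ h
    simp only [mem_sigma, mem_powerset, mem_product, mem_words_iff, mem_sdiff] at h ⊢
    obtain ⟨hA, ⟨n₁, e₁⟩, n₂, e₂⟩ := h
    refine ⟨?_, fun a => ?_⟩
    · rw [List.nodup_append]
      refine ⟨n₁, List.nodup_cons.2 ⟨fun h => hm ((e₂ m).1 h).1, n₂⟩, ?_⟩
      rintro a ha b hb rfl
      rcases List.mem_cons.1 hb with rfl | hb
      · exact hm (hA ((e₁ _).1 ha))
      · exact ((e₂ _).1 hb).2 ((e₁ _).1 ha)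
    · simp only [List.mem_append, List.mem_cons, e₁, e₂, mem_insert]
      have := @hA a
      tauto
  · rintro ⟨A, l₁, l₂⟩ h ⟨A', l₁', l₂'⟩ h' e
    simp only [coe_sigma, Set.mem_sigma_iff, mem_coe, mem_powerset, mem_product,
      mem_words_iff, mem_sdiff] at h h'
    obtain ⟨hA, ⟨n₁, e₁⟩, n₂, e₂⟩ := h
    obtain ⟨hA', ⟨n₁', e₁'⟩, n₂', e₂'⟩ := h'
    have k₁ : m ∉ l₁ := fun h => hm (hA ((e₁ m).1 h))
    have k₂ : m ∉ l₂ := fun h => hm ((e₂ m).1 h).1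
    dsimp only at e
    obtain ⟨rfl, -, rfl⟩ := (List.append_cons_inj_of_notMem k₁ k₂).1 e
    have : A = A' := by ext a; rw [← e₁, e₁']
    subst this
    rfl
  · intro l h
    simp only [mem_coe, mem_words_iff, mem_insert] at h
    obtain ⟨hn, e⟩ := h
    obtain ⟨l₁, l₂, rfl⟩ := List.append_of_mem ((e m).2 (Or.inl rfl))
    rw [List.nodup_append, List.nodup_cons] at hn
    obtain ⟨n₁, ⟨hm₂, n₂⟩, hd⟩ := hn
    have hT : ∀ a, a ∈ T ↔ a ∈ l₁ ∨ a ∈ l₂ := by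
      intro a
      have h := e a
      simp only [List.mem_append, List.mem_cons] at h
      by_cases ham : a = m
      · subst ham
        have : a ∉ l₁ := fun h => hd a h a (by simp) rfl
        tauto
      · tauto
    refine ⟨⟨l₁.toFinset, l₁, l₂⟩, ?_, rfl⟩
    simp only [coe_sigma, Set.mem_sigma_iff, mem_coe, mem_powerset, mem_product,
      mem_words_iff, mem_sdiff, List.mem_toFinset]
    refine ⟨fun a ha => (hT a).2 (Or.inl (List.mem_toFinset.1 ha)), ⟨n₁, by simp⟩, n₂, ?_⟩
    intro a
    rw [hT]
    have : a ∈ l₁ → a ∉ l₂ := fun h₁ h₂ => hd a h₁ a (by simp [h₂]) rfl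
    tauto

theorem altDesWeight_map_strictAntiOn (p : Bool) (l : List α) (f : α → α) (hl : l.Nodup)
    (hf : StrictAntiOn f {a | a ∈ l}) :
    altDesWeight x p (l.map f) = altDesWeight x (!p) l := by
  induction l generalizing p with
  | nil => simp [altDesWeight]
  | cons a t ih =>
    cases t with
    | nil => simp [altDesWeight]
    | cons b t =>
      have ih := ih (!p) hl.of_cons (hf.mono fun c hc => List.mem_cons_of_mem _ hc)
      have hab : a ≠ b := by rintro rfl; simp at hl
      have h := hf.lt_iff_gt (a := b) (b := a) (by simp) (by simp)
      simp only [List.map_cons] at ih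
      simp only [List.map_cons, altDesWeight, ih, h]
      rcases hab.lt_or_gt with h | h <;> cases p <;> simp [h, h.le]

theorem exists_strictAntiOn_involution (S : Finset α) :
    ∃ f : α → α, StrictAntiOn f S ∧ ∀ a ∈ S, f a ∈ S ∧ f (f a) = a := by
  let e := S.orderIsoOfFin rfl
  refine ⟨fun a => if h : a ∈ S then (e (Fin.rev (e.symm ⟨a, h⟩)) : α) else a, ?_, ?_⟩
  · intro a ha b hb hab
    rw [mem_coe] at ha hb
    simp only [ha, hb, dif_pos, Subtype.coe_lt_coe, OrderIso.lt_iff_lt, Fin.rev_lt_rev]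
    exact hab
  · intro a ha
    simp [ha]

theorem sum_altDesWeight_not (p : Bool) (S : Finset α) :
    ∑ l ∈ words S, altDesWeight x (!p) l = ∑ l ∈ words S, altDesWeight x p l := by
  obtain ⟨f, hf, hS⟩ := exists_strictAntiOn_involution S
  have key : ∀ l ∈ words S, l.map f ∈ words S ∧ (l.map f).map f = l := by
    intro l hl
    rw [mem_words_iff] at hl
    have hinv : (l.map f).map f = l := by
      rw [List.map_map]
      conv_rhs => rw [← List.map_id l]
      exact List.map_congr_left fun a ha => (hS a ((hl.2 a).1 ha)).2
    refine ⟨mem_words_iff.2 ⟨?_, fun a => ?_⟩, hinv⟩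
    · exact List.Nodup.of_map f (by rw [hinv]; exact hl.1)
    · rw [List.mem_map]
      constructor
      · rintro ⟨b, hb, rfl⟩
        exact (hS b ((hl.2 b).1 hb)).1
      · intro ha
        exact ⟨f a, (hl.2 _).2 (hS a ha).1, (hS a ha).2⟩
  refine Finset.sum_nbij' (List.map f) (List.map f) (fun l hl => (key l hl).1)
    (fun l hl => (key l hl).1) (fun l hl => (key l hl).2) (fun l hl => (key l hl).2) ?_
  intro l hl
  rw [mem_words_iff] at hl
  refine (altDesWeight_map_strictAntiOn x p l f hl.1 (hf.mono fun a ha => ?_)).symm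
  exact (hl.2 a).1 ha

theorem sum_altDesWeight_eq (p q : Bool) (S : Finset α) :
    ∑ l ∈ words S, altDesWeight x p l = ∑ l ∈ words S, altDesWeight x q l := by
  rcases Bool.eq_or_eq_not p q with rfl | rfl
  · rfl
  · exact sum_altDesWeight_not x q S

theorem sum_altDesWeight_insert_max (p : Bool) (T : Finset α) (m : α) (hm : ∀ a ∈ T, a < m) :
    ∑ l ∈ words (insert m T), altDesWeight x p l =
      ∑ A ∈ T.powerset, (if p ^^ A.card.bodd then x else 1) ^
        ((if A.card = 0 then 0 else 1) + if (T \ A).card = 0 then 0 else 1) *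
        ((∑ l ∈ words A, altDesWeight x true l) *
          ∑ l ∈ words (T \ A), altDesWeight x true l) := by
  rw [sum_words_insert T m fun h => lt_irrefl m (hm m h)]
  refine Finset.sum_congr rfl fun A hA => ?_
  rw [sum_altDesWeight_eq x true p A, sum_altDesWeight_eq x true (!(p ^^ A.card.bodd)) (T \ A),
    Finset.sum_mul_sum, Finset.mul_sum]
  refine Finset.sum_congr rfl fun l₁ h₁ => ?_
  rw [Finset.mul_sum]
  refine Finset.sum_congr rfl fun l₂ h₂ => ?_
  rw [altDesWeight_append_cons_max, length_of_mem_words h₁, length_of_mem_words h₂]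
  · exact fun a ha => hm a (mem_powerset.1 hA (((mem_words_iff.1 h₁).2 a).1 ha))
  · exact fun a ha => hm a (mem_sdiff.1 (((mem_words_iff.1 h₂).2 a).1 ha)).1

theorem sum_shapeWeight_insert_max (T : Finset α) (m : α) (hm : ∀ a ∈ T, a < m) :
    ∑ l ∈ words (insert m T), shapeWeight x false l =
      ∑ A ∈ T.powerset,
        (x ^ ((if A.card = 0 then 0 else 1) + if (T \ A).card = 0 then 0 else 1) + 1) *
        ((∑ l ∈ words A, shapeWeight x false l) *
          ∑ l ∈ words (T \ A), shapeWeight x false l) := by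
  rw [sum_words_insert T m fun h => lt_irrefl m (hm m h)]
  refine Finset.sum_congr rfl fun A hA => ?_
  rw [Finset.sum_mul_sum, Finset.mul_sum]
  refine Finset.sum_congr rfl fun l₁ h₁ => ?_
  rw [Finset.mul_sum]
  refine Finset.sum_congr rfl fun l₂ h₂ => ?_
  rw [shapeWeight_false_append_cons_max, length_of_mem_words h₁, length_of_mem_words h₂]
  · exact fun a ha => hm a (mem_powerset.1 hA (((mem_words_iff.1 h₁).2 a).1 ha))
  · exact fun a ha => hm a (mem_sdiff.1 (((mem_words_iff.1 h₂).2 a).1 ha)).1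

theorem two_pow_card_mul_sum_altDesWeight (S : Finset α) :
    2 ^ S.card * ∑ l ∈ words S, altDesWeight x true l =
      ∑ l ∈ words S, shapeWeight x false l := by
  induction S using Finset.strongInduction with
  | H S ih =>
    rcases S.eq_empty_or_nonempty with rfl | hS
    · have h : words (∅ : Finset α) = {[]} := by
        ext l
        rw [mem_words_iff_coe_eq, mem_singleton, Finset.empty_val, Multiset.coe_eq_zero]
      simp [h, altDesWeight, shapeWeight]
    · obtain ⟨m, T, hm, rfl⟩ : ∃ m T, (∀ a ∈ T, a < m) ∧ S = insert m T :=
        ⟨S.max' hS, S.erase (S.max' hS), fun a ha => S.lt_max'_of_mem_erase_max' hS ha,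
          (Finset.insert_erase (S.max'_mem hS)).symm⟩
      have hmT : m ∉ T := fun h => lt_irrefl m (hm m h)
      have h2 : 2 * ∑ l ∈ words (insert m T), altDesWeight x true l =
          ∑ A ∈ T.powerset,
            (x ^ ((if A.card = 0 then 0 else 1) + if (T \ A).card = 0 then 0 else 1) + 1) *
            ((∑ l ∈ words A, altDesWeight x true l) *
              ∑ l ∈ words (T \ A), altDesWeight x true l) := by
        rw [two_mul]
        conv_lhs => arg 2; rw [sum_altDesWeight_eq x true false]
        rw [sum_altDesWeight_insert_max x _ T m hm, sum_altDesWeight_insert_max x _ T m hm,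
          ← Finset.sum_add_distrib]
        refine Finset.sum_congr rfl fun A _ => ?_
        cases A.card.bodd <;> simp <;> ring
      rw [Finset.card_insert_of_notMem hmT, pow_succ, mul_assoc, h2,
        sum_shapeWeight_insert_max x T m hm, Finset.mul_sum]
      refine Finset.sum_congr rfl fun A hA => ?_
      have hAT := mem_powerset.1 hA
      have hT : T ⊂ insert m T := Finset.ssubset_insert hmT
      rw [← ih A (hAT.trans_ssubset hT), ← ih (T \ A) (sdiff_subset.trans_ssubset hT),
        ← Finset.card_sdiff_add_card_eq_card hAT, pow_add]
      ring

theorem altDesWeight_map_strictMono {β : Type*} [LinearOrder β] (p : Bool) (l : List α)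
    {f : α → β} (hf : StrictMono f) :
    altDesWeight x p (l.map f) = altDesWeight x p l := by
  induction l generalizing p with
  | nil => simp [altDesWeight]
  | cons a t ih =>
    cases t with
    | nil => simp [altDesWeight]
    | cons b t =>
      have ih := ih (!p)
      simp only [List.map_cons] at ih
      simp only [List.map_cons, altDesWeight, ih, hf.lt_iff_lt]

theorem shapeWeight_map_strictMono {β : Type*} [LinearOrder β] (up : Bool) (l : List α)
    {f : α → β} (hf : StrictMono f) :
    shapeWeight x up (l.map f) = shapeWeight x up l := by
  induction l generalizing up with
  | nil => simp [shapeWeight]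
  | cons a t ih =>
    cases t with
    | nil => simp [shapeWeight]
    | cons b t =>
      have ih := ih (decide (a < b))
      simp only [List.map_cons] at ih
      simp only [List.map_cons, shapeWeight, ih, hf.lt_iff_lt]

theorem altDesWeight_ofFn (p : Bool) (m : ℕ) (w : ℕ → α) :
    altDesWeight x p (List.ofFn fun i : Fin (m + 1) => w i) =
      ∏ i ∈ range m, if (p ^^ i.bodd) = decide (w (i + 1) < w i) then x else 1 := by
  induction m generalizing p w with
  | zero => simp [altDesWeight]
  | succ m ih =>
    have ih := ih (!p) fun i => w (i + 1)
    rw [List.ofFn_succ] at ih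
    rw [List.ofFn_succ, List.ofFn_succ, altDesWeight, Finset.prod_range_succ', mul_comm]
    simp only [Fin.val_succ, Fin.val_zero] at ih ⊢
    rw [ih]
    simp [Nat.bodd_succ]

theorem shapeWeight_ofFn (m : ℕ) (w : ℕ → α) (hw : w m < w (m + 1)) :
    shapeWeight x (decide (w 0 < w 1)) (List.ofFn fun i : Fin m => w (i + 1)) =
      ∏ i ∈ range m, entryWeight x (decide (w i < w (i + 1)))
        (decide (w (i + 1) < w (i + 2))) := by
  induction m generalizing w with
  | zero => simp [shapeWeight]
  | succ m ih =>
    have ih := ih (fun i => w (i + 1)) hw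
    rw [List.ofFn_succ, Finset.prod_range_succ', mul_comm]
    cases m with
    | zero => simpa [shapeWeight] using by rw [decide_eq_true hw]
    | succ m =>
      rw [List.ofFn_succ] at ih ⊢
      rw [shapeWeight]
      simp only [Fin.val_succ, Fin.val_zero, zero_add] at ih ⊢
      rw [← ih]

end Words

theorem sum_perm_ofFn (n : ℕ) (g : List (Fin n) → ℝ) :
    ∑ σ : Equiv.Perm (Fin n), g (List.ofFn σ) =
      ∑ l ∈ words (univ : Finset (Fin n)), g l := by
  refine Finset.sum_nbij (fun σ => List.ofFn σ) ?_ ?_ ?_ fun _ _ => rfl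
  · intro σ _
    rw [mem_words_iff]
    refine ⟨List.nodup_ofFn.2 σ.injective, fun a => ?_⟩
    simpa [List.mem_ofFn] using σ.surjective a
  · intro σ _ τ _ h
    exact DFunLike.coe_injective (List.ofFn_injective h)
  · intro l hl
    have hlen : l.length = n := by simpa using length_of_mem_words hl
    have hl := (mem_words_iff.1 hl).1
    let f : Fin n → Fin n := fun i => l.get (i.cast hlen.symm)
    have hf : Function.Injective f :=
      (List.nodup_iff_injective_get.1 hl).comp (Fin.cast_injective _)
    refine ⟨Equiv.ofBijective f (Finite.injective_iff_bijective.1 hf), by simp, ?_⟩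
    refine List.ext_getElem (by simp [hlen]) fun i h₁ h₂ => ?_
    simp [f]

theorem extA_of_mem {n i : ℕ} (σ : Equiv.Perm (Fin n)) (hi : i < n) :
    extA n σ (i + 1) = (σ ⟨i, hi⟩ : ℕ) + 1 := by
  simp [extA, Nat.succ_le_of_lt hi]

theorem ofFn_extA (n : ℕ) (σ : Equiv.Perm (Fin n)) :
    (List.ofFn fun i : Fin n => extA n σ (i + 1)) =
      (List.ofFn σ).map fun i : Fin n => (i : ℕ) + 1 := by
  rw [List.map_ofFn]
  congr 1
  funext i
  simp [extA_of_mem]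

theorem extA_ne_extA_succ {n i : ℕ} (hn : 0 < n) (σ : Equiv.Perm (Fin n)) (hi : i ≤ n) :
    extA n σ i ≠ extA n σ (i + 1) := by
  have h0 : extA n σ 0 = n + 1 := by simp [extA]
  have hlast : extA n σ (n + 1) = n + 1 := by simp [extA]
  rcases i with _ | i
  · rw [h0, extA_of_mem σ hn]
    have := (σ ⟨0, hn⟩).2
    omega
  · rw [extA_of_mem σ hi]
    rcases hi.lt_or_eq with h | h
    · rw [extA_of_mem σ h]
      intro e
      have := σ.injective (Fin.ext (Nat.succ_injective e))
      simp at this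
    · have := (σ ⟨i, hi⟩).2
      rw [h, hlast]
      omega

theorem pow_altDesA {n : ℕ} (hn : 0 < n) (x : ℝ) (σ : Equiv.Perm (Fin n)) :
    x ^ altDesA n σ = altDesWeight x true (List.ofFn σ) := by
  have hmono : StrictMono fun i : Fin n => (i : ℕ) + 1 := fun i j h => Nat.succ_lt_succ h
  obtain ⟨m, rfl⟩ : ∃ m, n = m + 1 := ⟨n - 1, by omega⟩
  rw [← altDesWeight_map_strictMono x true _ hmono, ← ofFn_extA,
    altDesWeight_ofFn x true m fun i => extA (m + 1) σ (i + 1), altDesA, ← Finset.prod_const,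
    Finset.prod_filter, Finset.prod_Ico_eq_prod_range]
  refine Finset.prod_congr (by simp) fun i hi => ?_
  have hi : i < m := by simpa using hi
  have hne := extA_ne_extA_succ hn σ (i := i + 1) (by omega)
  rw [add_comm 1 i]
  have hb : i.bodd = decide (Odd i) := by
    simp only [Nat.odd_iff, Nat.mod_two_of_bodd]
    cases i.bodd <;> rfl
  refine if_congr ?_ rfl rfl
  rw [hb, Nat.odd_add_one, Nat.even_add_one, Nat.not_even_iff_odd]
  rcases hne.lt_or_gt with h | h <;> by_cases ho : Odd i <;> simp [h, h.le, ho]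

theorem shapeWeight_ofFn_perm {n : ℕ} (hn : 0 < n) (x : ℝ) (σ : Equiv.Perm (Fin n)) :
    (1 + x) ^ ddaCount n (extA n σ) * 2 ^ valCount n (extA n σ) *
      (1 + x ^ 2) ^ pkCount n (extA n σ) = shapeWeight x false (List.ofFn σ) := by
  have hmono : StrictMono fun i : Fin n => (i : ℕ) + 1 := fun i j h => Nat.succ_lt_succ h
  have h0 : extA n σ 0 = n + 1 := by simp [extA]
  have hlast : extA n σ (n + 1) = n + 1 := by simp [extA]
  have hle : ∀ i, extA n σ i ≤ n + 1 := by
    intro i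
    unfold extA
    split_ifs <;> omega
  have hup : decide (extA n σ 0 < extA n σ 1) = false := by
    rw [h0]
    simpa using hle 1
  have hlt : extA n σ n < extA n σ (n + 1) :=
    lt_of_le_of_ne ((hle n).trans_eq hlast.symm) (extA_ne_extA_succ hn σ le_rfl)
  rw [← shapeWeight_map_strictMono x false _ hmono, ← ofFn_extA, ← hup,
    shapeWeight_ofFn x n _ hlt, ddaCount, pow_add, daCount, ddCount, valCount, pkCount]
  simp only [← Finset.prod_const, Finset.prod_filter, ← Finset.prod_mul_distrib]
  rw [← Finset.Ico_add_one_right_eq_Icc, Finset.prod_Ico_eq_prod_range]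
  refine Finset.prod_congr (by simp) fun i hi => ?_
  have hi : i < n := by simpa using hi
  have h₁ := extA_ne_extA_succ hn σ (i := i) hi.le
  have h₂ := extA_ne_extA_succ hn σ (i := i + 1) hi
  rw [add_comm 1 i, Nat.add_sub_cancel]
  rcases h₁.lt_or_gt with h₁ | h₁ <;> rcases h₂.lt_or_gt with h₂ | h₂ <;>
    simp [h₁, h₂, h₁.not_gt, h₂.not_gt, entryWeight]

/-- For every positive integer `n` and real `x`,
`2^n · Â_n(x) = ∑_{σ ∈ S_n} (1+x)^{dda(σ)} · 2^{val(σ)} · (1+x²)^{pk(σ)}`,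
with the boundary convention `σ(0) = σ(n+1) = n+1`. -/
theorem stmt0 (n : ℕ) (hn : 0 < n) (x : ℝ) :
    2 ^ n * hatA n x =
      ∑ σ : Equiv.Perm (Fin n),
        (1 + x) ^ ddaCount n (extA n σ) * 2 ^ valCount n (extA n σ) *
          (1 + x ^ 2) ^ pkCount n (extA n σ) := by
  rw [hatA, Finset.sum_congr rfl fun σ _ => pow_altDesA hn x σ,
    Finset.sum_congr rfl fun σ _ => shapeWeight_ofFn_perm hn x σ,
    sum_perm_ofFn n (altDesWeight x true), sum_perm_ofFn n (shapeWeight x false),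
    ← two_pow_card_mul_sum_altDesWeight, Finset.card_univ, Fintype.card_fin]
end

section
/- For every positive integer n and every real number x with x ≠ 1, 2^n · (1+x^2) · Â_n(x) = (1−x)^{n+1} · P_n((1+x)/(1−x)), where P_n is the n-th derivative polynomial of the tangent function. -/
open Finset

/-- The weight of a word: a factor `x` for each adjacent pair `a, c` with `r a c` equal to the
current sign, where the sign starts at the given Boolean and alternates along the word. -/
noncomputable def altWeight (x : ℝ) (r : ℕ → ℕ → Bool) : Bool → List ℕ → ℝ
  | _, [] => 1
  | _, [_] => 1
  | b, a :: c :: l => (if r a c = b then x else 1) * altWeight x r (!b) (c :: l)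

theorem altWeight_cons_cons (x : ℝ) (r : ℕ → ℕ → Bool) (b : Bool) (a c : ℕ) (l : List ℕ) :
    altWeight x r b (a :: c :: l) =
      (if r a c = b then x else 1) * altWeight x r (!b) (c :: l) :=
  rfl

/-- The finset of all orderings of the elements of `S`. -/
def orderings (S : Finset ℕ) : Finset (List ℕ) :=
  ⟨S.val.lists, Multiset.lists_nodup_finset S⟩

/-- The total weight of all orderings of the elements of `S`. -/
noncomputable def altSum (x : ℝ) (r : ℕ → ℕ → Bool) (b : Bool) (S : Finset ℕ) : ℝ :=
  ∑ l ∈ orderings S, altWeight x r b l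

theorem mem_orderings {S : Finset ℕ} {l : List ℕ} :
    l ∈ orderings S ↔ l.Nodup ∧ l.toFinset = S := by
  rw [orderings, Finset.mem_mk, Multiset.mem_lists_iff]
  constructor
  · intro h
    have h' : S.val = (l : Multiset ℕ) := h
    have hd : l.Nodup := by rw [← Multiset.coe_nodup, ← h']; exact S.nodup
    refine ⟨hd, ?_⟩
    ext a
    rw [List.mem_toFinset, ← Finset.mem_val, h', Multiset.mem_coe]
  · rintro ⟨hd, rfl⟩
    simp [List.toFinset_val, hd.dedup]

theorem altWeight_not (x : ℝ) (r : ℕ → ℕ → Bool) (b : Bool) (l : List ℕ) :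
    altWeight x (fun a c => !r a c) b l = altWeight x r (!b) l := by
  induction l generalizing b with
  | nil => simp [altWeight]
  | cons a l ih =>
    cases l with
    | nil => simp [altWeight]
    | cons c l => simp [altWeight, ih, Bool.not_eq_eq_eq_not]

theorem altSum_not (x : ℝ) (r : ℕ → ℕ → Bool) (b : Bool) (S : Finset ℕ) :
    altSum x (fun a c => !r a c) b S = altSum x r (!b) S :=
  sum_congr rfl fun l _ => altWeight_not x r b l

/-- The contribution of the two neighbours of an extreme letter with sign `s`, with `i` letters
on its left and `j` letters on its right. -/
noncomputable def extremeFactor (x : ℝ) (s : Bool) (i j : ℕ) : ℝ :=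
  (if i ≠ 0 ∧ s then x else 1) * (if j ≠ 0 ∧ s then x else 1)

theorem altWeight_append_cons (x : ℝ) (r : ℕ → ℕ → Bool) (b : Bool) (m : ℕ) (L R : List ℕ)
    (hL : ∀ y ∈ L, r y m = false) (hR : ∀ y ∈ R, r m y = true) :
    altWeight x r b (L ++ m :: R) =
      extremeFactor x (b == decide (Even L.length)) L.length R.length *
        (altWeight x r b L * altWeight x r (b != decide (Even L.length)) R) := by
  induction L generalizing b with
  | nil =>
    cases R with
    | nil => simp [altWeight, extremeFactor]
    | cons c R => cases b <;> simp_all [altWeight, extremeFactor]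
  | cons a L ih =>
    have ih' := ih (!b) fun y hy => hL y (List.mem_cons_of_mem _ hy)
    cases L with
    | nil =>
      have := hL a (by simp)
      simp only [List.nil_append, List.cons_append] at ih' ⊢
      rw [altWeight_cons_cons, ih']
      cases b <;> simp_all [altWeight, extremeFactor, mul_assoc]
    | cons c L =>
      simp only [List.cons_append] at ih' ⊢
      rw [altWeight_cons_cons, ih']
      have e : decide (Even (c :: L).length) = !decide (Even (a :: c :: L).length) := by
        simp [Nat.even_add_one, -Nat.not_even_iff_odd]
      rw [e, altWeight_cons_cons]
      cases b <;> simp only [extremeFactor, List.length_cons, ne_eq, Nat.add_eq_zero_iff,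
        one_ne_zero, and_false, not_false_eq_true, true_and, Bool.not_false, Bool.not_true,
        Bool.true_beq, Bool.false_beq, Bool.not_not, Bool.true_bne, Bool.false_bne] <;> ring

theorem altSum_eq_sum_powerset (x : ℝ) (r : ℕ → ℕ → Bool) (b : Bool) (m : ℕ) (S : Finset ℕ)
    (hm : m ∉ S) (h₁ : ∀ y ∈ S, r y m = false) (h₂ : ∀ y ∈ S, r m y = true) :
    altSum x r b (insert m S) = ∑ T ∈ S.powerset,
      extremeFactor x (b == decide (Even #T)) #T #(S \ T) *
        (altSum x r b T * altSum x r (b != decide (Even #T)) (S \ T)) := by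
  simp only [altSum, sum_mul_sum, ← sum_product']
  simp only [mul_sum]
  rw [sum_sigma']
  symm
  refine sum_bij (fun p _ => p.2.1 ++ m :: p.2.2) ?_ ?_ ?_ ?_
  · rintro ⟨T, L, R⟩ h
    simp only [mem_sigma, mem_powerset, mem_product, mem_orderings] at h ⊢
    obtain ⟨hT, ⟨hL, rfl⟩, hR, hRT⟩ := h
    have hR' : ∀ y ∈ R, y ∈ S ∧ y ∉ L := by
      intro y hy
      have : y ∈ R.toFinset := by simpa using hy
      rw [hRT] at this
      simpa using this
    have hL' : ∀ y ∈ L, y ∈ S := fun y hy => hT (by simpa using hy)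
    constructor
    · rw [List.nodup_append', List.nodup_cons]
      refine ⟨hL, ⟨fun h => hm (hR' m h).1, hR⟩, ?_⟩
      intro y hy hy'
      rcases List.mem_cons.1 hy' with rfl | h
      · exact hm (hL' y hy)
      · exact (hR' y h).2 hy
    · simp only [List.toFinset_append, List.toFinset_cons, hRT, union_insert]
      rw [union_sdiff_of_subset hT]
  · rintro ⟨T, L, R⟩ h ⟨T', L', R'⟩ h' heq
    simp only [mem_sigma, mem_powerset, mem_product, mem_orderings] at h h' heq
    obtain ⟨hT, ⟨hL, rfl⟩, hR, hRT⟩ := h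
    obtain ⟨hT', ⟨hL', rfl⟩, hR', hRT'⟩ := h'
    have n₁ : m ∉ L := fun h => hm (hT (by simpa using h))
    have n₂ : m ∉ L' := fun h => hm (hT' (by simpa using h))
    have n₃ : m ∉ R := fun h => by
      have : m ∈ R.toFinset := by simpa using h
      rw [hRT] at this
      exact hm (mem_sdiff.1 this).1
    have n₄ : m ∉ R' := fun h => by
      have : m ∈ R'.toFinset := by simpa using h
      rw [hRT'] at this
      exact hm (mem_sdiff.1 this).1
    obtain ⟨rfl, rfl⟩ : L = L' ∧ R = R' := by
      have := List.append_cons_inj_of_notMem n₁ n₃ |>.1 heq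
      simpa using this
    rfl
  · intro l hl
    rw [mem_orderings] at hl
    obtain ⟨hd, hl⟩ := hl
    have hml : m ∈ l := by
      rw [← List.mem_toFinset, hl]; exact mem_insert_self _ _
    obtain ⟨L, R, rfl⟩ := List.append_of_mem hml
    rw [List.nodup_append', List.nodup_cons] at hd
    obtain ⟨hL, ⟨hmR, hR⟩, hLR⟩ := hd
    have hmL : m ∉ L := fun h => hLR h (by simp)
    have key : ∀ y, y ≠ m → (y ∈ S ↔ y ∈ L ∨ y ∈ R) := fun y hy => by
      have := Finset.ext_iff.1 hl y
      simp [hy] at this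
      tauto
    refine ⟨⟨L.toFinset, L, R⟩, ?_, rfl⟩
    simp only [mem_sigma, mem_powerset, mem_product, mem_orderings]
    refine ⟨?_, ⟨hL, trivial⟩, hR, ?_⟩
    · intro y hy
      rw [List.mem_toFinset] at hy
      exact (key y (by rintro rfl; exact hmL hy)).2 (Or.inl hy)
    · ext y
      by_cases hy : y = m
      · subst hy; simp [hm, hmR]
      · have := @hLR y
        simp only [List.mem_toFinset, mem_sdiff, key y hy]
        simp only [List.mem_cons] at this
        tauto
  · rintro ⟨T, L, R⟩ h
    simp only [mem_sigma, mem_powerset, mem_product, mem_orderings] at h ⊢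
    obtain ⟨hT, ⟨hL, hLT⟩, hR, hRT⟩ := h
    rw [altWeight_append_cons]
    · have c₁ : L.length = #T := by rw [← hLT, List.toFinset_card_of_nodup hL]
      have c₂ : R.length = #(S \ T) := by rw [← hRT, List.toFinset_card_of_nodup hR]
      rw [c₁, c₂]
    · intro y hy
      exact h₁ y (hT (by simpa [← hLT] using hy))
    · intro y hy
      have : y ∈ R.toFinset := by simpa using hy
      rw [hRT] at this
      exact h₂ y (mem_sdiff.1 this).1

theorem altSum_insert_of_card (x : ℝ) (r : ℕ → ℕ → Bool) (b : Bool) (m : ℕ) (S : Finset ℕ)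
    (hm : m ∉ S) (h₁ : ∀ y ∈ S, r y m = false) (h₂ : ∀ y ∈ S, r m y = true) (c : ℕ → ℝ)
    (hc : ∀ T ⊆ S, ∀ b, altSum x r b T = c #T) :
    altSum x r b (insert m S) = ∑ k ∈ range (#S + 1), (#S).choose k *
      (extremeFactor x (b == decide (Even k)) k (#S - k) * (c k * c (#S - k))) := by
  rw [altSum_eq_sum_powerset x r b m S hm h₁ h₂]
  simp_rw [← nsmul_eq_mul]
  rw [← sum_powerset_apply_card (fun k =>
    extremeFactor x (b == decide (Even k)) k (#S - k) * (c k * c (#S - k)))]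
  refine sum_congr rfl fun T hT => ?_
  rw [mem_powerset] at hT
  rw [hc T hT, hc _ sdiff_subset, card_sdiff_of_subset hT]

theorem extremeFactor_add_not (x : ℝ) (s : Bool) (i j : ℕ) :
    extremeFactor x s i j + extremeFactor x (!s) i j =
      1 + (if i = 0 then 1 else x) * (if j = 0 then 1 else x) := by
  cases s <;> simp [extremeFactor, add_comm]

theorem altSum_eq_of_recurrence (x : ℝ) (c : ℕ → ℝ) (h₀ : c 0 = 1)
    (hc : ∀ n, 2 * c (n + 1) = ∑ k ∈ range (n + 1), n.choose k *
      ((1 + (if k = 0 then 1 else x) * (if n - k = 0 then 1 else x)) * (c k * c (n - k))))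
    (b : Bool) (S : Finset ℕ) :
    altSum x (fun a d => decide (d ≤ a)) b S = c #S := by
  generalize hn : #S = n
  induction n using Nat.strong_induction_on generalizing b S with
  | _ n ih =>
    rcases S.eq_empty_or_nonempty with rfl | hS
    · subst hn
      have : orderings ∅ = {[]} := by
        ext l
        rw [mem_orderings]
        simp only [List.toFinset_eq_empty_iff, mem_singleton]
        constructor
        · exact And.right
        · rintro rfl; simp
      simp [altSum, this, altWeight, h₀]
    · obtain ⟨n, rfl⟩ : ∃ k, n = k + 1 := ⟨n - 1, by have := hS.card_pos; omega⟩
      have hmax : ∀ b, altSum x (fun a d => decide (d ≤ a)) b S =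
          ∑ k ∈ range (n + 1), n.choose k *
            (extremeFactor x (b == decide (Even k)) k (n - k) * (c k * c (n - k))) := by
        intro b
        have hM := S.max'_mem hS
        have hcard : #(S.erase (S.max' hS)) = n := by rw [card_erase_of_mem hM]; omega
        conv_lhs => rw [← insert_erase hM]
        rw [altSum_insert_of_card x _ b _ _ (notMem_erase _ _) ?_ ?_ c ?_, hcard]
        · intro y hy
          have := S.le_max' y (mem_of_mem_erase hy)
          have := ne_of_mem_erase hy
          simp only [decide_eq_false_iff_not, not_le]
          omega
        · intro y hy
          simpa using S.le_max' y (mem_of_mem_erase hy)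
        · intro T hT b
          have := card_le_card hT
          exact ih _ (by omega) b T rfl
      have hmin : ∀ b, altSum x (fun a d => decide (d ≤ a)) b S =
          ∑ k ∈ range (n + 1), n.choose k *
            (extremeFactor x (!(b == decide (Even k))) k (n - k) * (c k * c (n - k))) := by
        intro b
        have hM := S.min'_mem hS
        have hcard : #(S.erase (S.min' hS)) = n := by rw [card_erase_of_mem hM]; omega
        rw [← Bool.not_not b, ← altSum_not]
        conv_lhs => rw [← insert_erase hM]
        rw [altSum_insert_of_card x _ (!b) _ _ (notMem_erase _ _) ?_ ?_ c ?_, hcard]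
        · refine sum_congr rfl fun k _ => ?_
          rw [Bool.not_not]
          cases b <;> simp
        · intro y hy
          simpa using S.min'_le y (mem_of_mem_erase hy)
        · intro y hy
          have := S.min'_le y (mem_of_mem_erase hy)
          have := ne_of_mem_erase hy
          simp only [decide_eq_false_iff_not, Bool.not_eq_true', not_le]
          omega
        · intro T hT b
          have := card_le_card hT
          rw [altSum_not]
          exact ih _ (by omega) (!b) T rfl
      have : 2 * altSum x (fun a d => decide (d ≤ a)) b S = 2 * c (n + 1) := by
        rw [hc, two_mul]
        nth_rewrite 1 [hmax]
        rw [hmin, ← sum_add_distrib]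
        refine sum_congr rfl fun k _ => ?_
        rw [← extremeFactor_add_not x (b == decide (Even k))]
        ring
      linarith

theorem altWeight_map_range' (x : ℝ) (u : ℕ → ℕ) (s n : ℕ)
    (hu : Set.InjOn u (Set.Ico s (s + n))) :
    altWeight x (fun a d => decide (d ≤ a)) (decide (Odd s)) ((List.range' s n).map u) =
      x ^ #{i ∈ Ico s (s + n - 1) |
        (Odd i ∧ u (i + 1) < u i) ∨ (Even i ∧ u i < u (i + 1))} := by
  induction n generalizing s with
  | zero => simp [altWeight]
  | succ n ih =>
    cases n with
    | zero => simp [altWeight]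
    | succ n =>
      have ih' := ih (s + 1) (hu.mono (Set.Ico_subset_Ico (by omega) (by omega)))
      have hne : u s ≠ u (s + 1) := fun h => by
        have := hu (by simp) (by simp) h
        omega
      rw [List.range'_succ, List.map_cons] at ih' ⊢
      rw [List.range'_succ, List.map_cons, altWeight]
      have hs : (!decide (Odd s)) = decide (Odd (s + 1)) := by
        simp [Nat.odd_add_one, -Nat.not_odd_iff_even]
      rw [hs, ih', show s + 1 + (n + 1) - 1 = s + (n + 1 + 1) - 1 by omega,
        ← Finset.insert_Ico_add_one_left_eq_Ico (show s < s + (n + 1 + 1) - 1 by omega),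
        filter_insert]
      split_ifs with h₁ h₂ h₂
      · rw [card_insert_of_notMem (by simp), pow_succ']
      · exfalso
        rcases Nat.even_or_odd s with h | h
        · have := Nat.not_odd_iff_even.2 h
          simp [this] at h₁
          tauto
        · simp [h] at h₁
          exact h₂ (Or.inl ⟨h, by omega⟩)
      · exfalso
        apply h₁
        rcases h₂ with ⟨h, h'⟩ | ⟨h, h'⟩
        · simp [h]; omega
        · have := Nat.not_odd_iff_even.2 h
          simp [this]; omega
      · rw [one_mul]

theorem extA_succ (n : ℕ) (σ : Equiv.Perm (Fin n)) (i : Fin n) :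
    extA n σ (i + 1) = σ i + 1 := by
  have := i.2
  simp [extA]

theorem extA_injOn (n : ℕ) (σ : Equiv.Perm (Fin n)) : Set.InjOn (extA n σ) (Set.Ico 1 (1 + n)) := by
  intro i hi j hj h
  obtain ⟨i, rfl⟩ : ∃ k : Fin n, i = k + 1 := ⟨⟨i - 1, by grind⟩, by grind⟩
  obtain ⟨j, rfl⟩ : ∃ k : Fin n, j = k + 1 := ⟨⟨j - 1, by grind⟩, by grind⟩
  rw [extA_succ, extA_succ] at h
  have : σ i = σ j := Fin.ext (by omega)
  rw [σ.injective this]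

theorem hatA_eq_altSum (n : ℕ) (x : ℝ) :
    hatA n x = altSum x (fun a d => decide (d ≤ a)) true (Icc 1 n) := by
  refine sum_bij (fun σ _ => (List.range' 1 n).map (extA n σ)) ?_ ?_ ?_ ?_
  · intro σ _
    rw [mem_orderings]
    have hd : ((List.range' 1 n).map (extA n σ)).Nodup := by
      refine List.Nodup.map_on ?_ List.nodup_range'
      intro i hi j hj h
      rw [List.mem_range'_1] at hi hj
      exact extA_injOn n σ hi hj h
    refine ⟨hd, eq_of_subset_of_card_le ?_ ?_⟩
    · intro y hy
      simp only [List.mem_toFinset, List.mem_map, List.mem_range'_1] at hy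
      obtain ⟨i, hi, rfl⟩ := hy
      obtain ⟨i, rfl⟩ : ∃ k : Fin n, i = k + 1 := ⟨⟨i - 1, by omega⟩, by simp; omega⟩
      have := (σ i).2
      rw [extA_succ, mem_Icc]
      omega
    · rw [List.toFinset_card_of_nodup hd]
      simp
  · intro σ _ τ _ h
    ext i
    rw [List.map_inj_left] at h
    have := h (i + 1) (by rw [List.mem_range'_1]; omega)
    rw [extA_succ, extA_succ] at this
    omega
  · intro l hl
    rw [mem_orderings] at hl
    obtain ⟨hd, hl⟩ := hl
    have hlen : l.length = n := by
      rw [← List.toFinset_card_of_nodup hd, hl]; simp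
    subst hlen
    have hmem : ∀ i : Fin l.length, 1 ≤ l[i] ∧ l[i] ≤ l.length := fun i => by
      rw [← mem_Icc, ← hl, List.mem_toFinset]
      exact List.getElem_mem _
    let f : Fin l.length → Fin l.length := fun i => ⟨l[i] - 1, by have := hmem i; omega⟩
    have hf : Function.Injective f := by
      intro i j h
      have h' : l[i] - 1 = l[j] - 1 := congrArg Fin.val h
      have := hmem i
      have := hmem j
      exact hd.injective_get (show l[i] = l[j] by omega)
    refine ⟨Equiv.ofBijective f (Finite.injective_iff_bijective.1 hf), mem_univ _, ?_⟩
    refine List.ext_getElem (by simp) fun i h₁ h₂ => ?_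
    have := extA_succ _ (Equiv.ofBijective f (Finite.injective_iff_bijective.1 hf)) ⟨i, h₂⟩
    have h := hmem ⟨i, h₂⟩
    simp only [List.getElem_map, List.getElem_range', one_mul]
    rw [add_comm, this]
    simp [f] at h ⊢
    omega
  · intro σ _
    have := altWeight_map_range' x (extA n σ) 1 n (extA_injOn n σ)
    simp only [odd_one, decide_true, add_tsub_cancel_left] at this
    rw [this, altDesA]

theorem tanP_succ_eq_sum (n : ℕ) :
    tanP (n + 1) = (if n = 0 then 1 else 0) +
      ∑ p ∈ antidiagonal n, (n.choose p.1 : Polynomial ℝ) * (tanP p.1 * tanP p.2) := by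
  induction n with
  | zero => simp [tanP]; ring
  | succ n ih =>
    have e := Finset.sum_antidiagonal_choose_succ_mul (R := Polynomial ℝ)
      (fun i j => tanP i * tanP j) n
    rw [e, tanP, ih]
    have hd : Polynomial.derivative (if n = 0 then (1 : Polynomial ℝ) else 0) = 0 := by
      split_ifs <;> simp
    simp only [Polynomial.derivative_add, hd, zero_add, Polynomial.derivative_sum, mul_sum,
      Nat.add_eq_zero_iff, one_ne_zero, and_false, if_false]
    rw [← sum_add_distrib]
    refine sum_congr rfl fun p hp => ?_
    have hch : n.choose p.2 = n.choose p.1 := by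
      rw [HasAntidiagonal.mem_antidiagonal] at hp
      exact Nat.choose_symm_of_eq_add (by omega)
    simp only [Polynomial.derivative_mul, Polynomial.derivative_natCast, tanP, hch]
    ring

/-- For every positive integer `n` and real `x ≠ 1`,
`2^n · (1+x²) · Â_n(x) = (1-x)^{n+1} · P_n((1+x)/(1-x))`. -/
theorem stmt2 (n : ℕ) (hn : 0 < n) (x : ℝ) (hx : x ≠ 1) :
    2 ^ n * (1 + x ^ 2) * hatA n x =
      (1 - x) ^ (n + 1) * (tanP n).eval ((1 + x) / (1 - x)) := by
  have hx' : 1 - x ≠ 0 := sub_ne_zero.2 hx.symm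
  have hq : 1 + x ^ 2 ≠ 0 := by positivity
  set t := (1 + x) / (1 - x) with ht
  let d : ℕ → ℝ := fun k => (1 - x) ^ (k + 1) * (tanP k).eval t / 2 ^ k
  have hd0 : d 0 = 1 + x := by simp [d, tanP, ht]; field_simp
  have hd1 : d 1 = 1 + x ^ 2 := by simp [d, tanP, ht]; field_simp; ring
  have hd : ∀ n, n ≠ 0 → 2 * d (n + 1) =
      ∑ k ∈ range (n + 1), n.choose k * (d k * d (n - k)) := by
    intro n hn
    simp only [d, tanP_succ_eq_sum n, hn, if_false, zero_add, Polynomial.eval_finsetSum,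
      Polynomial.eval_mul, Polynomial.eval_natCast]
    rw [Finset.Nat.sum_antidiagonal_eq_sum_range_succ
      (fun i j => (n.choose i : ℝ) * ((tanP i).eval t * (tanP j).eval t)), mul_sum, sum_div,
      mul_sum]
    refine sum_congr rfl fun k hk => ?_
    obtain ⟨j, rfl⟩ : ∃ j, n = k + j := ⟨n - k, by grind⟩
    rw [Nat.add_sub_cancel_left]
    field_simp
    ring
  let c : ℕ → ℝ := fun k => if k = 0 then 1 else d k / (1 + x ^ 2)
  have hc : ∀ n, 2 * c (n + 1) = ∑ k ∈ range (n + 1), n.choose k *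
      ((1 + (if k = 0 then 1 else x) * (if n - k = 0 then 1 else x)) * (c k * c (n - k))) := by
    intro n
    rcases eq_or_ne n 0 with rfl | hn
    · simp [c, hd1, hq]; norm_num
    · have : 2 * c (n + 1) = (2 * d (n + 1)) / (1 + x ^ 2) := by simp [c, mul_div_assoc]
      rw [this, hd n hn, sum_div]
      refine sum_congr rfl fun k hk => ?_
      rcases eq_or_ne k 0 with rfl | hk0
      · simp [c, hn, hd0]; ring
      · rcases eq_or_ne (n - k) 0 with hk1 | hk1
        · simp [c, hk0, hk1, hd0]; ring
        · simp only [c, hk0, hk1, if_false]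
          field_simp
  rw [hatA_eq_altSum, altSum_eq_of_recurrence x c (by simp [c]) hc]
  simp only [Nat.card_Icc, Nat.add_sub_cancel, c, hn.ne', if_false, d]
  field_simp
end

section
/- For every positive integer n and every real number x with x ≠ 1, B̂_n(x) = (1−x)^n · Q_n((1+x)/(1−x)), where Q_n is the n-th derivative polynomial of the secant function. -/
open Finset

open Polynomial in
/-- The substitution `y = (1+x)/(1-x)` turns the recurrence of `secQ` into a recurrence in `x`. -/
theorem secQ_eval_substitution {F : ℕ → ℝ → ℝ} (h0 : ∀ x, F 0 x = 1)
    (hF : ∀ n x, F (n + 1) x =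
      (1 + x + n * (1 + x ^ 2)) * F n x + (1 + x ^ 2) * (1 - x) * deriv (F n) x)
    (n : ℕ) {x : ℝ} (hx : x ≠ 1) :
    F n x = (1 - x) ^ n * (secQ n).eval ((1 + x) / (1 - x)) := by
  induction n generalizing x with
  | zero => simp [h0, secQ]
  | succ n ih =>
    have hx' : 1 - x ≠ 0 := sub_ne_zero.mpr hx.symm
    have hy : HasDerivAt (fun t : ℝ => (1 + t) / (1 - t)) (2 / (1 - x) ^ 2) x := by
      refine (((hasDerivAt_id x).const_add 1).div ((hasDerivAt_id x).const_sub 1) hx').congr_deriv ?_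
      simp only [id]
      ring
    have hQ := ((secQ n).hasDerivAt ((1 + x) / (1 - x))).comp x hy
    have hd := (((hasDerivAt_id x).const_sub 1).pow n).mul hQ
    have hev : F n =ᶠ[nhds x]
        fun t => (1 - t) ^ n * (secQ n).eval ((1 + t) / (1 - t)) := by
      filter_upwards [isOpen_ne.mem_nhds hx] with t ht using ih ht
    have hderiv : deriv (F n) x = _ := (hd.congr_of_eventuallyEq hev).deriv
    rw [hF, hderiv, ih hx]
    simp only [secQ, eval_add, eval_mul, eval_X, eval_one, eval_pow, id, Function.comp]
    rcases n with _ | n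
    · simp [secQ]
      field_simp
    · simp only [Nat.add_sub_cancel, Pi.pow_apply]
      generalize eval _ (secQ (n + 1)) = a
      generalize eval _ (derivative (secQ (n + 1))) = b
      push_cast
      field_simp
      ring

theorem wordB_zero (n : ℕ) (σ : Equiv.Perm (Fin n)) (ε : Fin n → Bool) :
    wordB n σ ε 0 = 0 := by
  simp [wordB]

theorem wordB_succ {n : ℕ} (σ : Equiv.Perm (Fin n)) (ε : Fin n → Bool) (i : Fin n) :
    wordB n σ ε (i + 1) = if ε i then ((σ i : ℕ) + 1 : ℤ) else -((σ i : ℕ) + 1 : ℤ) := by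
  have h : 1 ≤ (i : ℕ) + 1 ∧ (i : ℕ) + 1 ≤ n := by omega
  simp [wordB, h]

theorem abs_wordB_le (n : ℕ) (σ : Equiv.Perm (Fin n)) (ε : Fin n → Bool) (i : ℕ) :
    |wordB n σ ε i| ≤ n := by
  unfold wordB
  split_ifs with h
  · have := (σ ⟨i - 1, by omega⟩).isLt
    rw [abs_le]; omega
  · have := (σ ⟨i - 1, by omega⟩).isLt
    rw [abs_le]; omega
  · simp

/-- Insert the maximal value at position `k` into a permutation. -/
def insertMax {n : ℕ} (k : Fin (n + 1)) (σ : Equiv.Perm (Fin n)) : Equiv.Perm (Fin (n + 1)) :=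
  (finSuccEquiv' k).trans ((Equiv.optionCongr σ).trans (finSuccEquiv' (Fin.last n)).symm)

theorem insertMax_self {n : ℕ} (k : Fin (n + 1)) (σ : Equiv.Perm (Fin n)) :
    insertMax k σ k = Fin.last n := by
  simp [insertMax]

theorem insertMax_succAbove {n : ℕ} (k : Fin (n + 1)) (σ : Equiv.Perm (Fin n)) (i : Fin n) :
    insertMax k σ (k.succAbove i) = (σ i).castSucc := by
  simp [insertMax]

/-- Insert a sign at position `k` into a sign vector and negate all later signs. -/
def insertSign {n : ℕ} (k : Fin (n + 1)) (b : Bool) (ε : Fin n → Bool) : Fin (n + 1) → Bool :=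
  k.insertNth b fun i => if i.castSucc < k then ε i else !ε i

theorem insertSign_self {n : ℕ} (k : Fin (n + 1)) (b : Bool) (ε : Fin n → Bool) :
    insertSign k b ε k = b := by
  simp [insertSign]

theorem insertSign_succAbove {n : ℕ} (k : Fin (n + 1)) (b : Bool) (ε : Fin n → Bool)
    (i : Fin n) :
    insertSign k b ε (k.succAbove i) = if i.castSucc < k then ε i else !ε i := by
  simp [insertSign]

/-- Every signed permutation of order `n + 1` arises exactly once by inserting a letter of maximal
absolute value into a signed permutation of order `n` and negating the letters after it. -/
theorem insert_bijective (n : ℕ) :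
    Function.Bijective fun q : (Equiv.Perm (Fin n) × (Fin n → Bool)) × Fin (n + 1) × Bool =>
      (insertMax q.2.1 q.1.1, insertSign q.2.1 q.2.2 q.1.2) := by
  rw [Fintype.bijective_iff_injective_and_card]
  constructor
  · rintro ⟨⟨σ, ε⟩, k, b⟩ ⟨⟨τ, δ⟩, l, c⟩ h
    obtain ⟨hσ, hε⟩ := Prod.ext_iff.mp h
    dsimp only at hσ hε
    have hkl : k = l := (insertMax l τ).injective <| by
      rw [insertMax_self, ← hσ, insertMax_self]
    subst hkl
    have hστ : σ = τ := by
      ext i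
      have := DFunLike.congr_fun hσ (k.succAbove i)
      rw [insertMax_succAbove, insertMax_succAbove, Fin.castSucc_inj] at this
      rw [this]
    have hbc : b = c := by
      simpa only [insertSign_self] using congrFun hε k
    have hεδ : ε = δ := by
      funext i
      have := congrFun hε (k.succAbove i)
      rw [insertSign_succAbove, insertSign_succAbove] at this
      split_ifs at this <;> simpa using this
    rw [hστ, hbc, hεδ]
  · simp [Fintype.card_perm, Nat.factorial_succ, pow_succ]
    ring

section InsertedWord

variable {n : ℕ} (σ : Equiv.Perm (Fin n)) (ε : Fin n → Bool) (k : Fin (n + 1)) (b : Bool)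

theorem wordB_insert_of_le {i : ℕ} (hi : i ≤ k) :
    wordB (n + 1) (insertMax k σ) (insertSign k b ε) i = wordB n σ ε i := by
  rcases i with _ | i
  · simp only [wordB_zero]
  · have hlt : (⟨i, by omega⟩ : Fin n).castSucc < k := by
      rw [Fin.lt_def]; exact hi
    have h := wordB_succ (insertMax k σ) (insertSign k b ε) (k.succAbove ⟨i, by omega⟩)
    rw [insertMax_succAbove, insertSign_succAbove, if_pos hlt,
      Fin.succAbove_of_castSucc_lt _ _ hlt] at h
    exact h.trans (wordB_succ σ ε ⟨i, by omega⟩).symm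

theorem wordB_insert_self :
    wordB (n + 1) (insertMax k σ) (insertSign k b ε) (k + 1) =
      if b then (n + 1 : ℤ) else -(n + 1 : ℤ) := by
  rw [wordB_succ, insertMax_self, insertSign_self, Fin.val_last]

theorem wordB_insert_of_lt {i : ℕ} (hi : (k : ℕ) < i) (hin : i ≤ n) :
    wordB (n + 1) (insertMax k σ) (insertSign k b ε) (i + 1) = -wordB n σ ε i := by
  obtain ⟨i, rfl⟩ : ∃ j, i = j + 1 := ⟨i - 1, by omega⟩
  have hle : k ≤ (⟨i, by omega⟩ : Fin n).castSucc := by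
    rw [Fin.le_def]; exact Nat.le_of_lt_succ hi
  have h := wordB_succ (insertMax k σ) (insertSign k b ε) (k.succAbove ⟨i, by omega⟩)
  rw [insertMax_succAbove, insertSign_succAbove, if_neg (not_lt.mpr hle),
    Fin.succAbove_of_le_castSucc _ _ hle] at h
  refine h.trans ?_
  rw [wordB_succ σ ε ⟨i, by omega⟩]
  cases ε ⟨i, by omega⟩ <;> simp

theorem isAltDesZ_insert_of_lt {i : ℕ} (hi : i < k) :
    isAltDesZ (wordB (n + 1) (insertMax k σ) (insertSign k b ε)) i ↔
      isAltDesZ (wordB n σ ε) i := by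
  rw [isAltDesZ, isAltDesZ, wordB_insert_of_le σ ε k b hi.le, wordB_insert_of_le σ ε k b hi]

theorem isAltDesZ_insert_self :
    isAltDesZ (wordB (n + 1) (insertMax k σ) (insertSign k b ε)) k ↔ (b ↔ Even (k : ℕ)) := by
  have h := abs_le.mp (abs_wordB_le n σ ε k)
  rw [isAltDesZ, wordB_insert_of_le σ ε k b le_rfl, wordB_insert_self, ← Nat.not_even_iff_odd]
  by_cases hk : Even (k : ℕ) <;> cases b <;> simp [hk] <;> omega

theorem isAltDesZ_insert_succ (hk : (k : ℕ) < n) :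
    isAltDesZ (wordB (n + 1) (insertMax k σ) (insertSign k b ε)) (k + 1) ↔
      (b ↔ Even (k : ℕ)) := by
  have h := abs_le.mp (abs_wordB_le n σ ε (k + 1))
  rw [isAltDesZ, wordB_insert_self, wordB_insert_of_lt σ ε k b (Nat.lt_succ_self _) hk,
    ← Nat.not_even_iff_odd, Nat.even_add_one]
  by_cases hk : Even (k : ℕ) <;> cases b <;> simp [hk] <;> omega

theorem isAltDesZ_insert_of_gt {i : ℕ} (hi : (k : ℕ) < i) (hin : i < n) :
    isAltDesZ (wordB (n + 1) (insertMax k σ) (insertSign k b ε)) (i + 1) ↔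
      isAltDesZ (wordB n σ ε) i := by
  rw [isAltDesZ, isAltDesZ, wordB_insert_of_lt σ ε k b hi hin.le,
    wordB_insert_of_lt σ ε k b (i := i + 1) (by omega) hin, neg_lt_neg_iff, neg_lt_neg_iff,
    Nat.even_add_one, Nat.odd_add_one, Nat.not_even_iff_odd, Nat.not_odd_iff_even, or_comm]

theorem altDesB_insert_last :
    altDesB (n + 1) (insertMax (Fin.last n) σ) (insertSign (Fin.last n) b ε) =
      altDesB n σ ε + if (b ↔ Even n) then 1 else 0 := by
  unfold altDesB
  rw [card_filter, card_filter, sum_range_succ]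
  have hself := isAltDesZ_insert_self σ ε (Fin.last n) b
  rw [Fin.val_last] at hself
  simp only [hself]
  congr 1
  refine sum_congr rfl fun i hi => ?_
  simp only [isAltDesZ_insert_of_lt σ ε (Fin.last n) b (mem_range.mp hi)]

theorem altDesB_insert_of_lt (hk : (k : ℕ) < n) :
    altDesB (n + 1) (insertMax k σ) (insertSign k b ε) +
        (if isAltDesZ (wordB n σ ε) k then 1 else 0) =
      altDesB n σ ε + if (b ↔ Even (k : ℕ)) then 2 else 0 := by
  obtain ⟨m, hm⟩ : ∃ m, n = k + 1 + m := ⟨n - (k + 1), by omega⟩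
  have hm' : n + 1 = k + 1 + 1 + m := by omega
  unfold altDesB
  rw [card_filter, card_filter,
    show range (n + 1) = range (k + 1 + 1 + m) from congrArg range hm',
    show range n = range (k + 1 + m) from congrArg range hm, sum_range_add _ (k + 1 + 1) m,
    sum_range_add _ (k + 1) m, sum_range_succ _ (k + 1), sum_range_succ _ k, sum_range_succ _ k]
  simp only [isAltDesZ_insert_self σ ε k b, isAltDesZ_insert_succ σ ε k b hk]
  have h₁ : ∀ i ∈ range (k : ℕ),
      (if isAltDesZ (wordB (n + 1) (insertMax k σ) (insertSign k b ε)) i then 1 else 0) =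
        if isAltDesZ (wordB n σ ε) i then 1 else 0 := fun i hi => by
    simp only [isAltDesZ_insert_of_lt σ ε k b (mem_range.mp hi)]
  have h₂ : ∀ i ∈ range m,
      (if isAltDesZ (wordB (n + 1) (insertMax k σ) (insertSign k b ε)) (k + 1 + 1 + i)
        then 1 else 0) = if isAltDesZ (wordB n σ ε) (k + 1 + i) then 1 else 0 := fun i hi => by
    have := mem_range.mp hi
    rw [show (k + 1 + 1 + i : ℕ) = k + 1 + i + 1 by omega]
    simp only [isAltDesZ_insert_of_gt σ ε k b (i := k + 1 + i) (by omega) (by omega)]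
  rw [sum_congr rfl h₁, sum_congr rfl h₂]
  split_ifs <;> omega

end InsertedWord

/-- The generating function of all insertions into a fixed signed permutation. -/
theorem sum_pow_altDesB_insert {n : ℕ} (σ : Equiv.Perm (Fin n)) (ε : Fin n → Bool) (x : ℝ) :
    ∑ r : Fin (n + 1) × Bool, x ^ altDesB (n + 1) (insertMax r.1 σ) (insertSign r.1 r.2 ε) =
      (1 + x + n * (1 + x ^ 2)) * x ^ altDesB n σ ε +
        (1 + x ^ 2) * (1 - x) * (altDesB n σ ε * x ^ (altDesB n σ ε - 1)) := by
  set d := altDesB n σ ε with hd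
  have hlast : ∑ b : Bool, x ^ altDesB (n + 1) (insertMax (Fin.last n) σ)
      (insertSign (Fin.last n) b ε) = (1 + x) * x ^ d := by
    simp only [altDesB_insert_last, ← hd, Fintype.sum_bool]
    by_cases h : Even n <;> simp [h] <;> ring
  have hcast (k : Fin n) : ∑ b : Bool, x ^ altDesB (n + 1) (insertMax k.castSucc σ)
      (insertSign k.castSucc b ε) = (1 + x ^ 2) *
        (x ^ d + if isAltDesZ (wordB n σ ε) k then (1 - x) * x ^ (d - 1) else 0) := by
    have hb (b : Bool) := altDesB_insert_of_lt σ ε k.castSucc b k.isLt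
    have ht := hb true
    have hf := hb false
    simp only [Fin.val_castSucc, ← hd] at ht hf
    rw [Fintype.sum_bool]
    by_cases hs : isAltDesZ (wordB n σ ε) k
    · have hpos : 0 < d := card_pos.mpr ⟨k, by simp [hs]⟩
      obtain ⟨e, he⟩ : ∃ e, d = e + 1 := ⟨d - 1, by omega⟩
      rw [he] at ht hf ⊢
      rw [if_pos hs] at ht hf ⊢
      by_cases h : Even (k : ℕ)
      · simp only [h, if_true, if_false, Bool.false_eq_true, iff_true, add_zero] at ht hf
        rw [Nat.add_right_cancel (ht.trans (add_right_comm e 1 2)), Nat.add_right_cancel hf,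
          Nat.add_sub_cancel]
        ring
      · simp only [h, if_true, if_false, Bool.false_eq_true, iff_false, not_true, add_zero]
          at ht hf
        rw [Nat.add_right_cancel ht, Nat.add_right_cancel (hf.trans (add_right_comm e 1 2)),
          Nat.add_sub_cancel]
        ring
    · by_cases h : Even (k : ℕ)
      all_goals
        simp only [hs, h, if_true, if_false, Bool.false_eq_true,
          iff_true, iff_false, not_true, add_zero] at ht hf ⊢
        rw [ht, hf]
        ring
  have hcount : ∑ k : Fin n, (if isAltDesZ (wordB n σ ε) k then (1 - x) * x ^ (d - 1) else 0) =
      d * ((1 - x) * x ^ (d - 1)) := by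
    rw [Fin.sum_univ_eq_sum_range
      (fun i => if isAltDesZ (wordB n σ ε) i then (1 - x) * x ^ (d - 1) else 0) n,
      ← sum_filter, sum_const, nsmul_eq_mul, hd, altDesB]
  rw [Fintype.sum_prod_type, Fin.sum_univ_castSucc, hlast]
  simp only [hcast]
  rw [← mul_sum, sum_add_distrib, hcount]
  simp only [sum_const, card_univ, Fintype.card_fin, nsmul_eq_mul]
  ring

theorem deriv_hatB (n : ℕ) (x : ℝ) :
    deriv (hatB n) x = ∑ p : Equiv.Perm (Fin n) × (Fin n → Bool),
      altDesB n p.1 p.2 * x ^ (altDesB n p.1 p.2 - 1) :=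
  (HasDerivAt.fun_sum fun p _ => hasDerivAt_pow (altDesB n p.1 p.2) x).deriv

theorem hatB_succ (n : ℕ) (x : ℝ) :
    hatB (n + 1) x =
      (1 + x + n * (1 + x ^ 2)) * hatB n x + (1 + x ^ 2) * (1 - x) * deriv (hatB n) x := by
  rw [deriv_hatB, hatB, hatB, ← (insert_bijective n).sum_comp, Fintype.sum_prod_type, mul_sum,
    mul_sum, ← sum_add_distrib]
  exact sum_congr rfl fun p _ => sum_pow_altDesB_insert p.1 p.2 x

/-- For every positive integer `n` and real `x ≠ 1`,
`B̂_n(x) = (1-x)^n · Q_n((1+x)/(1-x))`. -/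
theorem stmt3 (n : ℕ) (hn : 0 < n) (x : ℝ) (hx : x ≠ 1) :
    hatB n x = (1 - x) ^ n * (secQ n).eval ((1 + x) / (1 - x)) := by
  exact secQ_eval_substitution (fun t => by simp [hatB, altDesB]) hatB_succ n hx
end

section
/- For every positive integer n and every real number x with x ≠ 1, (1−x)^n Q_n((1+x)/(1−x)) = ∑_{σ ∈ S_n^0} (1+x)^{dda(σ)} · 2^{val(σ)} · (1+x^2)^{pk(σ)}, where the sum is over all permutations σ of {1,...,n} with the boundary convention σ(0) = 0, σ(n+1) = n+1. -/
open Finset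

open Polynomial in
theorem X_mul_add_derivative_X_pow_mul (d k : ℕ) :
    (X : ℝ[X]) * (X ^ d * (1 + X ^ 2) ^ k) + (1 + X ^ 2) * derivative (X ^ d * (1 + X ^ 2) ^ k) =
      (2 * (k : ℝ[X]) + 1) * (X ^ (d + 1) * (1 + X ^ 2) ^ k) +
        (d : ℝ[X]) * (X ^ (d - 1) * (1 + X ^ 2) ^ (k + 1)) := by
  rcases d with _ | d <;> rcases k with _ | k <;>
    simp [derivative_mul, derivative_pow, C_ofNat] <;> ring

/-- Indicator of `w` having a peak at `i`. -/
def peakInd (w : ℕ → ℕ) (i : ℕ) : ℕ := if w (i - 1) < w i ∧ w (i + 1) < w i then 1 else 0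

theorem ext0_zero (n : ℕ) (σ : Equiv.Perm (Fin n)) : ext0 n σ 0 = 0 := by simp [ext0]

theorem ext0_of_lt {n : ℕ} (σ : Equiv.Perm (Fin n)) {i : ℕ} (hi : n < i) :
    ext0 n σ i = n + 1 := by
  have h1 : ¬ (1 ≤ i ∧ i ≤ n) := by omega
  have h2 : i ≠ 0 := by omega
  simp [ext0, h1, h2]

theorem ext0_succ {n : ℕ} (σ : Equiv.Perm (Fin n)) (i : Fin n) :
    ext0 n σ (i + 1) = σ i + 1 := by
  simp [ext0]

theorem ext0_le {n : ℕ} (σ : Equiv.Perm (Fin n)) {i : ℕ} (hi : i ≤ n) : ext0 n σ i ≤ n := by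
  rcases i with _ | i
  · simp [ext0_zero]
  · have := ext0_succ σ ⟨i, hi⟩
    simp only at this
    omega

theorem ext0_ne_succ {n : ℕ} (σ : Equiv.Perm (Fin n)) {i : ℕ} (hi : i ≤ n) :
    ext0 n σ i ≠ ext0 n σ (i + 1) := by
  rcases hi.eq_or_lt with rfl | hlt
  · have := ext0_le σ le_rfl
    rw [ext0_of_lt σ (Nat.lt_succ_self i)]
    omega
  have h2 := ext0_succ σ ⟨i, hlt⟩
  rcases i with _ | i
  · rw [ext0_zero]
    simp only at h2
    omega
  · have h1 := ext0_succ σ ⟨i, by omega⟩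
    simp only at h1 h2
    rw [h1, h2]
    intro h
    have := σ.injective (Fin.ext (Nat.succ_injective h))
    simp at this

theorem daCount_add_ddCount_add_valCount_add_pkCount {n : ℕ} (σ : Equiv.Perm (Fin n)) :
    ddaCount n (ext0 n σ) + valCount n (ext0 n σ) + pkCount n (ext0 n σ) = n := by
  simp only [ddaCount, daCount, ddCount, valCount, pkCount, card_filter, ← sum_add_distrib]
  rw [sum_congr rfl (g := fun _ => 1), sum_const, Nat.card_Icc]
  · simp
  intro i hi
  rw [mem_Icc] at hi
  have h1 := ext0_ne_succ σ (i := i - 1) (by omega)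
  have h2 := ext0_ne_succ σ hi.2
  rw [Nat.sub_add_cancel hi.1] at h1
  split_ifs <;> omega

theorem valCount_eq_pkCount {n : ℕ} (σ : Equiv.Perm (Fin n)) :
    valCount n (ext0 n σ) = pkCount n (ext0 n σ) := by
  set w := ext0 n σ with hw
  let a : ℕ → ℤ := fun i => if w i < w (i + 1) then 1 else 0
  have ha : ∀ m ≤ n, (valCount m w : ℤ) - pkCount m w = a m - a 0 := by
    intro m
    induction m with
    | zero => simp [valCount, pkCount]
    | succ m ih =>
      intro hm
      have h1 := ext0_ne_succ σ (i := m) (by omega)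
      have h2 := ext0_ne_succ σ hm
      rw [← hw] at h1 h2
      have ih := ih (by omega)
      simp only [valCount, pkCount, card_filter, sum_Icc_succ_top (Nat.le_add_left 1 m), a] at ih ⊢
      push_cast at ih ⊢
      split_ifs at ih ⊢ <;> omega
  have h0 : a 0 = 1 := by
    have := ext0_ne_succ σ (Nat.zero_le n)
    rw [ext0_zero] at this
    simp only [a, hw, ext0_zero]
    rw [if_pos (by omega)]
  have hn : a n = 1 := by
    have := ext0_le σ le_rfl
    simp only [a, hw]
    rw [ext0_of_lt σ (Nat.lt_succ_self n), if_pos (by omega)]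
  have := ha n le_rfl
  omega

/-- Insert the largest letter into the word of `σ` at position `j`. -/
def insertLast {n : ℕ} (j : Fin (n + 1)) (σ : Equiv.Perm (Fin n)) : Equiv.Perm (Fin (n + 1)) :=
  ((finSuccEquiv' j).trans σ.optionCongr).trans (finSuccEquiv' (Fin.last n)).symm

theorem insertLast_self {n : ℕ} (j : Fin (n + 1)) (σ : Equiv.Perm (Fin n)) :
    insertLast j σ j = Fin.last n := by
  simp [insertLast]

theorem insertLast_succAbove {n : ℕ} (j : Fin (n + 1)) (σ : Equiv.Perm (Fin n)) (i : Fin n) :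
    insertLast j σ (j.succAbove i) = (σ i).castSucc := by
  simp [insertLast]

theorem insertLast_bijective (n : ℕ) :
    Function.Bijective fun p : Fin (n + 1) × Equiv.Perm (Fin n) => insertLast p.1 p.2 := by
  rw [Fintype.bijective_iff_injective_and_card]
  constructor
  · rintro ⟨j, σ⟩ ⟨k, τ⟩ h
    simp only at h
    obtain rfl : j = k := (insertLast k τ).injective <| by
      rw [insertLast_self, ← h, insertLast_self]
    congr
    ext i : 1
    apply Fin.castSucc_injective
    rw [← insertLast_succAbove j, ← insertLast_succAbove j, h]
  · simp [Fintype.card_perm, Nat.factorial_succ]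

theorem ext0_insertLast_of_le {n : ℕ} (j : Fin (n + 1)) (σ : Equiv.Perm (Fin n)) {i : ℕ}
    (hi : i ≤ j) : ext0 (n + 1) (insertLast j σ) i = ext0 n σ i := by
  rcases i with _ | i
  · simp [ext0_zero]
  have h1 := ext0_succ σ ⟨i, by omega⟩
  have h2 := ext0_succ (insertLast j σ) (j.succAbove ⟨i, by omega⟩)
  rw [insertLast_succAbove, Fin.succAbove_of_castSucc_lt _ _ (by simpa [Fin.lt_def] using hi)] at h2
  simp only [Fin.val_castSucc] at h1 h2
  rw [h1, h2]

theorem ext0_insertLast_self {n : ℕ} (j : Fin (n + 1)) (σ : Equiv.Perm (Fin n)) :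
    ext0 (n + 1) (insertLast j σ) (j + 1) = n + 1 := by
  rw [ext0_succ, insertLast_self, Fin.val_last]

theorem ext0_insertLast_of_lt {n : ℕ} (j : Fin (n + 1)) (σ : Equiv.Perm (Fin n)) {i : ℕ}
    (hj : j < i) (hi : i ≤ n) : ext0 (n + 1) (insertLast j σ) (i + 1) = ext0 n σ i := by
  rcases i with _ | i
  · omega
  have h1 := ext0_succ σ ⟨i, by omega⟩
  have h2 := ext0_succ (insertLast j σ) (j.succAbove ⟨i, by omega⟩)
  rw [insertLast_succAbove,
    Fin.succAbove_of_le_castSucc _ _ (by simp [Fin.le_def]; omega)] at h2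
  simp only [Fin.val_castSucc, Fin.val_succ] at h1 h2
  rw [h1, h2]

theorem peakInd_zero (w : ℕ → ℕ) : peakInd w 0 = 0 := by simp [peakInd]

theorem peakInd_ext0_of_le {n : ℕ} (σ : Equiv.Perm (Fin n)) {i : ℕ} (hi : n ≤ i) :
    peakInd (ext0 n σ) i = 0 := by
  have h1 := ext0_of_lt σ (i := i + 1) (by omega)
  have h2 : ext0 n σ i ≤ n + 1 := by
    rcases hi.eq_or_lt with rfl | h
    · exact (ext0_le σ le_rfl).trans (Nat.le_succ _)
    · exact (ext0_of_lt σ h).le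
  simp only [peakInd]
  rw [if_neg (by omega)]

theorem pkCount_ext0_eq_sum {n : ℕ} (σ : Equiv.Perm (Fin n)) :
    pkCount n (ext0 n σ) = ∑ i ∈ range (n + 2), peakInd (ext0 n σ) i := by
  rw [sum_range_succ, peakInd_ext0_of_le σ (Nat.le_succ n), sum_range_succ',
    peakInd_zero, pkCount, card_filter, ← Ico_add_one_right_eq_Icc, sum_Ico_eq_sum_range]
  simp only [add_comm 1, Nat.add_sub_cancel]
  rfl

/-- The effect on the peak indicators of inserting a letter larger than all others
after position `j` of a word of length `j + m`. -/
theorem sum_peakInd_insert {j m : ℕ} {w w' : ℕ → ℕ} (hle : ∀ i ≤ j, w' i = w i)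
    (hself : w' (j + 1) = j + m + 1) (hlt : ∀ i, j < i → i ≤ j + m → w' (i + 1) = w i)
    (hwle : ∀ i ≤ j + m, w i ≤ j + m) (hz : ∀ i, j + m ≤ i → peakInd w i = 0)
    (hz' : ∀ i, j + m + 1 ≤ i → peakInd w' i = 0) :
    ∑ i ∈ range (j + m + 1 + 2), peakInd w' i + (peakInd w j + peakInd w (j + 1)) =
      ∑ i ∈ range (j + m + 2), peakInd w i + if j < j + m then 1 else 0 := by
  have e1 : ∑ i ∈ range j, peakInd w' i = ∑ i ∈ range j, peakInd w i := by
    refine sum_congr rfl fun i hi => ?_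
    rw [mem_range] at hi
    simp only [peakInd]
    rw [hle (i - 1) (by omega), hle i (by omega), hle (i + 1) (by omega)]
  have e2 : ∑ k ∈ range m, peakInd w' (j + 3 + k) = ∑ k ∈ range m, peakInd w (j + 2 + k) := by
    refine sum_congr rfl fun k hk => ?_
    rw [mem_range] at hk
    by_cases hk' : j + 2 + k < j + m
    · have h1 := hlt (j + 2 + k - 1) (by omega) (by omega)
      have h2 := hlt (j + 2 + k) (by omega) (by omega)
      have h3 := hlt (j + 2 + k + 1) (by omega) (by omega)
      rw [show j + 2 + k - 1 + 1 = j + 3 + k - 1 by omega] at h1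
      rw [show j + 2 + k + 1 = j + 3 + k by omega] at h2
      rw [show j + 2 + k + 1 + 1 = j + 3 + k + 1 by omega] at h3
      simp only [peakInd]
      rw [h1, h2, h3]
    · rw [hz _ (by omega), hz' _ (by omega)]
  have p0 : peakInd w' j = 0 := by
    have := hwle j (by omega)
    simp only [peakInd]
    rw [hself, hle j le_rfl, if_neg (by omega)]
  have p1 : peakInd w' (j + 1) = if j < j + m then 1 else 0 := by
    by_cases hm : j < j + m
    · have h1 := hwle j (by omega)
      have h2 := hwle (j + 1) (by omega)
      simp only [peakInd, Nat.add_sub_cancel]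
      rw [hself, hle j le_rfl, hlt (j + 1) (by omega) (by omega), if_pos (by omega), if_pos hm]
    · rw [if_neg hm, hz' _ (by omega)]
  have p2 : peakInd w' (j + 2) = 0 := by
    by_cases hm : j < j + m
    · have h2 := hwle (j + 1) (by omega)
      have h3 := hlt (j + 1) (by omega) (by omega)
      simp only [peakInd]
      rw [show j + 2 - 1 = j + 1 by omega, hself, h3, if_neg (by omega)]
    · rw [hz' _ (by omega)]
  rw [show j + m + 1 + 2 = j + 3 + m by omega, show j + m + 2 = j + 2 + m by omega,
    sum_range_add, sum_range_add _ (j + 2), e2, sum_range_succ, sum_range_succ, sum_range_succ,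
    sum_range_succ, sum_range_succ, e1, p0, p1, p2]
  ring

theorem pkCount_insertLast {n : ℕ} (j : Fin (n + 1)) (σ : Equiv.Perm (Fin n)) :
    pkCount (n + 1) (ext0 (n + 1) (insertLast j σ)) +
        (peakInd (ext0 n σ) j + peakInd (ext0 n σ) (j + 1)) =
      pkCount n (ext0 n σ) + if (j : ℕ) < n then 1 else 0 := by
  rw [pkCount_ext0_eq_sum, pkCount_ext0_eq_sum]
  obtain ⟨m, hm⟩ := Nat.exists_eq_add_of_le (Nat.lt_succ_iff.mp j.is_lt)
  have h := sum_peakInd_insert (j := j) (m := m) (w := ext0 n σ)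
    (w' := ext0 (n + 1) (insertLast j σ)) (fun i hi => ext0_insertLast_of_le j σ hi)
  rw [← hm] at h
  exact h (ext0_insertLast_self j σ) (fun i h1 h2 => ext0_insertLast_of_lt j σ h1 h2)
    (fun i hi => ext0_le σ hi) (fun i hi => peakInd_ext0_of_le σ hi)
    (fun i hi => peakInd_ext0_of_le _ hi)

theorem peakInd_add_peakInd_succ_le (w : ℕ → ℕ) (j : ℕ) :
    peakInd w j + peakInd w (j + 1) ≤ 1 := by
  simp only [peakInd, Nat.add_sub_cancel]
  split_ifs <;> omega

/-- The number of insertion slots that leave the peak count unchanged is `2 pk + 1`. -/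
theorem sum_peakInd_slots {n : ℕ} (σ : Equiv.Perm (Fin n)) :
    ∑ j ∈ range (n + 1),
        (peakInd (ext0 n σ) j + peakInd (ext0 n σ) (j + 1) + if j < n then 0 else 1) =
      2 * pkCount n (ext0 n σ) + 1 := by
  have h1 := pkCount_ext0_eq_sum σ
  have h2 := pkCount_ext0_eq_sum σ
  rw [sum_range_succ, peakInd_ext0_of_le σ (Nat.le_succ n)] at h1
  rw [sum_range_succ', peakInd_zero] at h2
  have h3 : ∑ j ∈ range (n + 1), (if j < n then 0 else 1) = 1 := by
    rw [sum_range_succ, sum_eq_zero fun j hj => if_pos (mem_range.mp hj)]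
    simp
  rw [sum_add_distrib, sum_add_distrib, h3]
  omega

open Polynomial in
theorem sum_insertLast {n : ℕ} (σ : Equiv.Perm (Fin n)) :
    ∑ j : Fin (n + 1), (X : ℝ[X]) ^ ddaCount (n + 1) (ext0 (n + 1) (insertLast j σ)) *
        (1 + X ^ 2) ^ pkCount (n + 1) (ext0 (n + 1) (insertLast j σ)) =
      X * (X ^ ddaCount n (ext0 n σ) * (1 + X ^ 2) ^ pkCount n (ext0 n σ)) +
        (1 + X ^ 2) *
          derivative (X ^ ddaCount n (ext0 n σ) * (1 + X ^ 2) ^ pkCount n (ext0 n σ)) := by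
  rw [X_mul_add_derivative_X_pow_mul]
  have hslots := sum_peakInd_slots σ
  have hd := daCount_add_ddCount_add_valCount_add_pkCount σ
  rw [valCount_eq_pkCount] at hd
  set d := ddaCount n (ext0 n σ)
  set k := pkCount n (ext0 n σ)
  set b : ℕ → ℕ := fun j =>
    peakInd (ext0 n σ) j + peakInd (ext0 n σ) (j + 1) + if j < n then 0 else 1 with hb
  set A : ℝ[X] := X ^ (d + 1) * (1 + X ^ 2) ^ k
  set B : ℝ[X] := X ^ (d - 1) * (1 + X ^ 2) ^ (k + 1)
  have hterm : ∀ j : Fin (n + 1),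
      (X : ℝ[X]) ^ ddaCount (n + 1) (ext0 (n + 1) (insertLast j σ)) *
        (1 + X ^ 2) ^ pkCount (n + 1) (ext0 (n + 1) (insertLast j σ)) =
      (b j : ℝ[X]) * A + (1 - (b j : ℝ[X])) * B := by
    intro j
    have h1 := pkCount_insertLast j σ
    have h2 := daCount_add_ddCount_add_valCount_add_pkCount (insertLast j σ)
    rw [valCount_eq_pkCount] at h2
    have h3 := peakInd_add_peakInd_succ_le (ext0 n σ) j
    have h4 : ¬ (j : ℕ) < n →
        peakInd (ext0 n σ) j = 0 ∧ peakInd (ext0 n σ) (j + 1) = 0 := fun h =>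
      ⟨peakInd_ext0_of_le σ (by omega), peakInd_ext0_of_le σ (by omega)⟩
    have hbj : b j = 1 ∨ b j = 0 := by
      simp only [hb]
      split_ifs with h <;> omega
    rcases hbj with h | h
    · have hpk : pkCount (n + 1) (ext0 (n + 1) (insertLast j σ)) = k := by
        simp only [hb] at h
        split_ifs at h h1 <;> omega
      have hdd : ddaCount (n + 1) (ext0 (n + 1) (insertLast j σ)) = d + 1 := by omega
      rw [hpk, hdd, h]
      simp [A]
    · have hpk : pkCount (n + 1) (ext0 (n + 1) (insertLast j σ)) = k + 1 := by
        simp only [hb] at h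
        split_ifs at h h1
        omega
      have hdd : ddaCount (n + 1) (ext0 (n + 1) (insertLast j σ)) = d - 1 := by omega
      rw [hpk, hdd, h]
      simp [B]
  have hcast : ∑ j : Fin (n + 1), (b j : ℝ[X]) = 2 * k + 1 := by
    rw [Fin.sum_univ_eq_sum_range (fun j => (b j : ℝ[X])) (n + 1)]
    exact_mod_cast congrArg (Nat.cast : ℕ → ℝ[X]) hslots
  have hn : (n : ℝ[X]) = d + k + k := by exact_mod_cast congrArg (Nat.cast : ℕ → ℝ[X]) hd.symm
  rw [sum_congr rfl fun j _ => hterm j, sum_add_distrib, ← sum_mul, ← sum_mul, sum_sub_distrib,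
    hcast]
  simp only [sum_const, card_univ, Fintype.card_fin, nsmul_eq_mul, Nat.cast_add, Nat.cast_one, hn]
  ring

open Polynomial in
theorem secQ_eq_sum (n : ℕ) :
    secQ n = ∑ σ : Equiv.Perm (Fin n),
      X ^ ddaCount n (ext0 n σ) * (1 + X ^ 2) ^ pkCount n (ext0 n σ) := by
  induction n with
  | zero => simp [secQ, ddaCount, daCount, ddCount, pkCount]
  | succ n ih =>
    rw [← (insertLast_bijective n).sum_comp fun σ =>
      (X : ℝ[X]) ^ ddaCount (n + 1) (ext0 (n + 1) σ) *
        (1 + X ^ 2) ^ pkCount (n + 1) (ext0 (n + 1) σ), Fintype.sum_prod_type_right,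
      sum_congr rfl fun σ _ => sum_insertLast σ, sum_add_distrib, ← mul_sum, ← mul_sum,
      ← derivative_sum, ← ih, secQ]

/-- For every positive integer `n` and real `x ≠ 1`,
`(1-x)^n Q_n((1+x)/(1-x)) = ∑_{σ ∈ S_n⁰} (1+x)^{dda(σ)} 2^{val(σ)} (1+x²)^{pk(σ)}`,
with the boundary convention `σ(0) = 0`, `σ(n+1) = n+1`. -/
theorem stmt9 (n : ℕ) (hn : 0 < n) (x : ℝ) (hx : x ≠ 1) :
    (1 - x) ^ n * (secQ n).eval ((1 + x) / (1 - x)) =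
      ∑ σ : Equiv.Perm (Fin n),
        (1 + x) ^ ddaCount n (ext0 n σ) * 2 ^ valCount n (ext0 n σ) *
          (1 + x ^ 2) ^ pkCount n (ext0 n σ) := by
  have hx' : 1 - x ≠ 0 := sub_ne_zero.mpr hx.symm
  rw [secQ_eq_sum, Polynomial.eval_finsetSum, mul_sum]
  refine sum_congr rfl fun σ _ => ?_
  have hd := daCount_add_ddCount_add_valCount_add_pkCount σ
  rw [valCount_eq_pkCount] at hd ⊢
  have h1 : (1 - x) * ((1 + x) / (1 - x)) = 1 + x := mul_div_cancel₀ _ hx'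
  have h2 : (1 - x) ^ 2 * (1 + ((1 + x) / (1 - x)) ^ 2) = 2 * (1 + x ^ 2) := by
    field_simp
    ring
  have h3 : (1 - x) ^ n = (1 - x) ^ ddaCount n (ext0 n σ) *
      ((1 - x) ^ 2) ^ pkCount n (ext0 n σ) := by
    rw [← pow_mul, ← pow_add]
    congr 1
    omega
  simp only [Polynomial.eval_mul, Polynomial.eval_pow, Polynomial.eval_X, Polynomial.eval_add,
    Polynomial.eval_one]
  rw [h3, mul_mul_mul_comm, ← mul_pow, ← mul_pow, h1, h2, mul_pow, mul_assoc]
end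

section
/- For every positive integer n and every real number x, 2^n · Â_n(x) = ∑_{π ∈ B_n} x^{d̂(π)}, where the sum is over all type B permutations π of order n and d̂(π) counts alternating descents of π at positions 1,...,n−1 only (position 0 is excluded). -/
open Finset

/-- The signed value attached to the letter `k + 1` when the signs are indexed by absolute value. -/
def signedValue {n : ℕ} (δ : Fin n → Bool) (k : Fin n) : ℤ :=
  if δ k then ((k : ℕ) + 1 : ℤ) else -((k : ℕ) + 1 : ℤ)

lemma signedValue_injective {n : ℕ} (δ : Fin n → Bool) :
    Function.Injective (signedValue δ) := by
  intro a b hab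
  unfold signedValue at hab
  ext
  split_ifs at hab <;> omega

/-- The rank of each signed value, as a permutation of `Fin n`. -/
def signedRank {n : ℕ} (δ : Fin n → Bool) : Equiv.Perm (Fin n) :=
  (Tuple.sort (signedValue δ)).symm

lemma signedRank_lt_iff {n : ℕ} (δ : Fin n → Bool) (a b : Fin n) :
    signedRank δ a < signedRank δ b ↔ signedValue δ a < signedValue δ b := by
  have h : StrictMono (signedValue δ ∘ Tuple.sort (signedValue δ)) :=
    (Tuple.monotone_sort (signedValue δ)).strictMono_of_injective
      ((signedValue_injective δ).comp (Equiv.injective _))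
  simpa [signedRank] using (h.lt_iff_lt (a := signedRank δ a) (b := signedRank δ b)).symm

lemma wordB_lt_iff {n : ℕ} (σ : Equiv.Perm (Fin n)) (δ : Fin n → Bool) {i j : ℕ}
    (hi : 1 ≤ i ∧ i ≤ n) (hj : 1 ≤ j ∧ j ≤ n) :
    wordB n σ (δ ∘ σ) i < wordB n σ (δ ∘ σ) j ↔
      extA n (signedRank δ * σ) i < extA n (signedRank δ * σ) j := by
  have h := signedRank_lt_iff δ (σ ⟨i - 1, by omega⟩) (σ ⟨j - 1, by omega⟩)
  rw [Fin.lt_def] at h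
  simp only [wordB, extA, dif_pos hi, dif_pos hj, Function.comp_apply, Equiv.Perm.mul_apply,
    add_lt_add_iff_right]
  exact h.symm

/-- Alternating descents of a signed word are those of its standardization. -/
lemma altDesWord_wordB_comp {n : ℕ} (σ : Equiv.Perm (Fin n)) (δ : Fin n → Bool) :
    altDesWord n (wordB n σ (δ ∘ σ)) = altDesA n (signedRank δ * σ) := by
  unfold altDesWord altDesA
  congr 1
  refine filter_congr fun i hi => ?_
  rw [mem_Ico] at hi
  have hi₁ : 1 ≤ i ∧ i ≤ n := by omega
  have hi₂ : 1 ≤ i + 1 ∧ i + 1 ≤ n := by omega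
  rw [isAltDesZ, wordB_lt_iff σ δ hi₁ hi₂, wordB_lt_iff σ δ hi₂ hi₁, or_comm]

/-- For every positive integer `n` and real `x`,
`2^n · Â_n(x) = ∑_{π ∈ B_n} x^{d̂(π)}`, where `d̂(π)` counts alternating descents of the
signed word `π` at positions `1,...,n-1` only. -/
theorem stmt10 (n : ℕ) (hn : 0 < n) (x : ℝ) :
    2 ^ n * hatA n x =
      ∑ p : Equiv.Perm (Fin n) × (Fin n → Bool),
        x ^ altDesWord n (wordB n p.1 p.2) := by
  calc 2 ^ n * hatA n x = ∑ _δ : Fin n → Bool, hatA n x := by simp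
    _ = ∑ δ : Fin n → Bool, ∑ σ : Equiv.Perm (Fin n), x ^ altDesA n (signedRank δ * σ) :=
        sum_congr rfl fun δ _ =>
          (Equiv.sum_comp (Equiv.mulLeft (signedRank δ)) fun σ => x ^ altDesA n σ).symm
    _ = ∑ σ : Equiv.Perm (Fin n), ∑ δ : Fin n → Bool, x ^ altDesWord n (wordB n σ (δ ∘ σ)) := by
        simp only [altDesWord_wordB_comp]
        exact sum_comm
    _ = ∑ σ : Equiv.Perm (Fin n), ∑ ε : Fin n → Bool, x ^ altDesWord n (wordB n σ ε) :=
        sum_congr rfl fun σ _ =>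
          Equiv.sum_comp (Equiv.arrowCongr σ.symm (Equiv.refl Bool)) fun ε =>
            x ^ altDesWord n (wordB n σ ε)
    _ = _ := (Fintype.sum_prod_type fun p : Equiv.Perm (Fin n) × (Fin n → Bool) =>
        x ^ altDesWord n (wordB n p.1 p.2)).symm
end

section
/- For every positive integer n, every permutation σ of {1,...,n}, and every real number x, ∑_{π ∈ Orb(σ)} x^{d̂(π)} = (1+x)^{dda(σ)} · 2^{val(σ)} · (1+x^2)^{pk(σ)}, where Orb(σ) is the set of 2^n signed words ε_1σ(1) ε_2σ(2) ··· ε_nσ(n) with each ε_i ∈ {+1,−1}, the statistics dda, val, pk are computed with the boundary convention σ(0) = σ(n+1) = n+1, and d̂(π) counts alternating descents of π at positions 1,...,n−1. -/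
open Finset

theorem extA_ne_succ (n : ℕ) (hn : 0 < n) (σ : Equiv.Perm (Fin n)) {i : ℕ} (hi : i ≤ n) :
    extA n σ i ≠ extA n σ (i + 1) := by
  unfold extA
  by_cases h1 : 1 ≤ i
  · by_cases h2 : i + 1 ≤ n
    · rw [dif_pos ⟨h1, hi⟩, dif_pos ⟨by omega, h2⟩]
      intro h
      have h' := σ.injective (Fin.ext (Nat.succ_injective h))
      simp only [Fin.mk.injEq] at h'
      omega
    · rw [dif_pos ⟨h1, hi⟩, dif_neg (by omega)]
      have := (σ ⟨i - 1, by omega⟩).isLt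
      omega
  · rw [dif_neg (by omega), dif_pos (by omega)]
    have := (σ ⟨i + 1 - 1, by omega⟩).isLt
    omega

theorem extA_le (n : ℕ) (σ : Equiv.Perm (Fin n)) (i : ℕ) : extA n σ i ≤ n + 1 := by
  unfold extA
  split <;> omega

/-- The weight contributed by the comparison of positions `j - 1` and `j` when the entry at `j` is
the larger one in absolute value, where `b` records whether that entry is positive; it is `1`
when the other entry is larger. -/
noncomputable def leftWeight (x : ℝ) (w : ℕ → ℕ) (j : ℕ) (b : Bool) : ℝ :=
  if w (j - 1) < w j ∧ (Odd j ↔ b = true) then x else 1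

/-- The weight contributed by the comparison of positions `j` and `j + 1` when the entry at `j` is
the larger one in absolute value, where `b` records whether that entry is positive; it is `1`
when the other entry is larger. -/
noncomputable def rightWeight (x : ℝ) (w : ℕ → ℕ) (j : ℕ) (b : Bool) : ℝ :=
  if w (j + 1) < w j ∧ (Odd j ↔ b = true) then x else 1

/-- Whether `i` is an alternating descent of a signed word depends only on the sign of the
entry of larger absolute value among those at `i` and `i + 1`. -/
theorem ite_isAltDesZ_eq_mul (x : ℝ) (w : ℕ → ℕ) (z : ℕ → ℤ) (s : ℕ → Bool) (i : ℕ)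
    (hz : z i = if s i then (w i : ℤ) else -w i)
    (hz' : z (i + 1) = if s (i + 1) then (w (i + 1) : ℤ) else -w (i + 1))
    (hne : w i ≠ w (i + 1)) :
    (if isAltDesZ z i then x else 1) =
      rightWeight x w i (s i) * leftWeight x w (i + 1) (s (i + 1)) := by
  have hdes : isAltDesZ z i ↔ (Even i ∧ z i < z (i + 1)) ∨ (Odd i ∧ z (i + 1) < z i) := Iff.rfl
  have hodd : Odd (i + 1) ↔ ¬ Odd i := Nat.odd_add_one
  have heven : Even i ↔ ¬ Odd i := Nat.not_odd_iff_even.symm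
  simp only [hdes, hodd, heven, rightWeight, leftWeight,
    hz, hz', Nat.add_sub_cancel]
  rcases lt_or_gt_of_ne hne with h | h <;> by_cases ho : Odd i <;>
    cases s i <;> cases s (i + 1) <;> simp [ho, h, h.not_gt] <;> omega

theorem sum_leftWeight_mul_rightWeight (x : ℝ) (w : ℕ → ℕ) (j : ℕ)
    (h : w (j - 1) ≠ w j) (h' : w j ≠ w (j + 1)) :
    ∑ b : Bool, leftWeight x w j b * rightWeight x w j b =
      (if w (j - 1) < w j ∧ w j < w (j + 1) then 1 + x else 1) *
      (if w j < w (j - 1) ∧ w (j + 1) < w j then 1 + x else 1) *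
      (if w j < w (j - 1) ∧ w j < w (j + 1) then 2 else 1) *
      (if w (j - 1) < w j ∧ w (j + 1) < w j then 1 + x ^ 2 else 1) := by
  unfold leftWeight rightWeight
  rw [Fintype.sum_bool]
  rcases lt_or_gt_of_ne h with h | h <;> rcases lt_or_gt_of_ne h' with h' | h' <;>
    by_cases ho : Odd j <;> simp [ho, h, h', h.not_gt, h'.not_gt] <;> ring

theorem pow_card_filter_eq_prod (s : Finset ℕ) (p : ℕ → Prop) [DecidablePred p] (y : ℝ) :
    y ^ (s.filter p).card = ∏ i ∈ s, if p i then y else 1 := by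
  rw [← prod_filter, prod_const]

theorem pow_altDesWord_eq_prod (n : ℕ) (hn : 0 < n) (σ : Equiv.Perm (Fin n)) (x : ℝ)
    (ε : Fin n → Bool) :
    x ^ altDesWord n (wordB n σ ε) =
      ∏ j : Fin n, leftWeight x (extA n σ) (j + 1) (ε j) *
        rightWeight x (extA n σ) (j + 1) (ε j) := by
  set w := extA n σ with hw
  let s : ℕ → Bool := fun i => if h : 1 ≤ i ∧ i ≤ n then ε ⟨i - 1, by omega⟩ else true
  have hz : ∀ i, 1 ≤ i → i ≤ n → wordB n σ ε i = if s i then (w i : ℤ) else -w i := by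
    intro i h1 h2
    simp [wordB, hw, extA, s, h1, h2]
  have hs : ∀ j : Fin n, s (j + 1) = ε j := fun j => by simp [s]
  have hedge : ∀ i ∈ Ico 1 n, (if isAltDesZ (wordB n σ ε) i then x else 1) =
      rightWeight x w i (s i) * leftWeight x w (i + 1) (s (i + 1)) := by
    intro i hi
    rw [mem_Ico] at hi
    exact ite_isAltDesZ_eq_mul x w _ s i (hz i hi.1 hi.2.le) (hz (i + 1) (by omega) hi.2)
      (extA_ne_succ n hn σ hi.2.le)
  have hfirst : leftWeight x w 1 (s 1) = 1 := by
    have h0 : w 0 = n + 1 := by simp [hw, extA]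
    have : w 1 ≤ n + 1 := extA_le n σ 1
    exact if_neg (by simp only [Nat.sub_self, h0]; omega)
  have hlast : rightWeight x w n (s n) = 1 := by
    have h0 : w (n + 1) = n + 1 := by simp [hw, extA]
    have : w n ≤ n + 1 := extA_le n σ n
    exact if_neg (by simp only [h0]; omega)
  obtain ⟨m, rfl⟩ : ∃ m, n = m + 1 := ⟨n - 1, by omega⟩
  simp_rw [← hs]
  rw [altDesWord, pow_card_filter_eq_prod, prod_congr rfl hedge, prod_mul_distrib,
    prod_mul_distrib, Fin.prod_univ_eq_prod_range (fun j => leftWeight x w (j + 1) (s (j + 1))),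
    Fin.prod_univ_eq_prod_range (fun j => rightWeight x w (j + 1) (s (j + 1))),
    prod_range_succ', prod_range_succ, hfirst, hlast, prod_Ico_eq_prod_range,
    prod_Ico_eq_prod_range, mul_one, mul_one, mul_comm]
  simp only [Nat.add_sub_cancel, add_comm 1]

/-- For every positive integer `n`, permutation `σ` of `{1,...,n}` and real `x`,
`∑_{π ∈ Orb(σ)} x^{d̂(π)} = (1+x)^{dda(σ)} · 2^{val(σ)} · (1+x²)^{pk(σ)}`, where `Orb(σ)` is the
set of `2^n` signed words obtained by attaching signs `ε_i ∈ {±1}` to the entries of `σ`,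
the statistics are computed with the boundary convention `σ(0) = σ(n+1) = n+1`, and `d̂(π)`
counts alternating descents at positions `1,...,n-1`. -/
theorem stmt11 (n : ℕ) (hn : 0 < n) (σ : Equiv.Perm (Fin n)) (x : ℝ) :
    ∑ ε : Fin n → Bool, x ^ altDesWord n (wordB n σ ε) =
      (1 + x) ^ ddaCount n (extA n σ) * 2 ^ valCount n (extA n σ) *
        (1 + x ^ 2) ^ pkCount n (extA n σ) := by
  rw [sum_congr rfl fun ε _ => pow_altDesWord_eq_prod n hn σ x ε,
    ← Fintype.prod_sum fun (j : Fin n) b => leftWeight x (extA n σ) (j + 1) b *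
      rightWeight x (extA n σ) (j + 1) b,
    prod_congr rfl fun (j : Fin n) _ => sum_leftWeight_mul_rightWeight x (extA n σ) (j + 1)
      (extA_ne_succ n hn σ j.isLt.le) (extA_ne_succ n hn σ j.isLt),
    Fin.prod_univ_eq_prod_range (fun j =>
      (if extA n σ (j + 1 - 1) < extA n σ (j + 1) ∧ extA n σ (j + 1) < extA n σ (j + 1 + 1)
        then 1 + x else 1) *
      (if extA n σ (j + 1) < extA n σ (j + 1 - 1) ∧ extA n σ (j + 1 + 1) < extA n σ (j + 1)
        then 1 + x else 1) *
      (if extA n σ (j + 1) < extA n σ (j + 1 - 1) ∧ extA n σ (j + 1) < extA n σ (j + 1 + 1)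
        then 2 else 1) *
      (if extA n σ (j + 1 - 1) < extA n σ (j + 1) ∧ extA n σ (j + 1 + 1) < extA n σ (j + 1)
        then 1 + x ^ 2 else 1)),
    ddaCount, pow_add, daCount, ddCount, valCount, pkCount]
  simp only [pow_card_filter_eq_prod, ← prod_mul_distrib]
  rw [← Ico_add_one_right_eq_Icc, prod_Ico_eq_prod_range]
  simp only [Nat.add_sub_cancel, add_comm 1]
end

section
/- Let σ be a permutation of {1,...,n} with boundary convention σ(0) = σ(n+1) = n+1, and let π = ε_1σ(1)···ε_nσ(n) and π' = ε_1'σ(1)···ε_n'σ(n) be two elements of Orb(σ). (i) If i ∈ {1,...,n} is a double ascent of σ with i−1 ∈ {1,...,n−1}, and ε_i = ε_i', then i−1 is an alternating descent of π if and only if i−1 is an alternating descent of π'. (ii) If i ∈ {1,...,n−1} is a double descent of σ and ε_i = ε_i', then i is an alternating descent of π if and only if i is an alternating descent of π'. -/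
open Finset

theorem wordB_eq_or_eq_neg_extA {n : ℕ} (σ : Equiv.Perm (Fin n)) (ε : Fin n → Bool) {i : ℕ}
    (h1 : 1 ≤ i) (hin : i ≤ n) :
    wordB n σ ε i = (extA n σ i : ℤ) ∨ wordB n σ ε i = -(extA n σ i : ℤ) := by
  have h : 1 ≤ i ∧ i ≤ n := ⟨h1, hin⟩
  simp only [wordB, extA, dif_pos h]
  split_ifs <;> simp

theorem wordB_congr_sign {n : ℕ} (σ : Equiv.Perm (Fin n)) {ε ε' : Fin n → Bool} {i : ℕ}
    (h1 : 1 ≤ i) (hin : i ≤ n) (hε : ε ⟨i - 1, by omega⟩ = ε' ⟨i - 1, by omega⟩) :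
    wordB n σ ε i = wordB n σ ε' i := by
  have h : 1 ≤ i ∧ i ≤ n := ⟨h1, hin⟩
  simp only [wordB, dif_pos h, hε]

theorem isAltDesZ_congr {w w' : ℕ → ℤ} {i : ℕ} (hlt : w i < w (i + 1) ↔ w' i < w' (i + 1))
    (hgt : w (i + 1) < w i ↔ w' (i + 1) < w' i) : isAltDesZ w i ↔ isAltDesZ w' i := by
  simp only [isAltDesZ, hlt, hgt]

/-- Let `σ` be a permutation of `{1,...,n}` (boundary convention
`σ(0) = σ(n+1) = n+1`) and let `π, π' ∈ Orb(σ)` be given by sign vectors `ε, ε'`.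
(i) If `i` is a double ascent of `σ` with `i-1 ∈ {1,...,n-1}` and the signs of `π(i)` and
`π'(i)` agree, then `i-1` is an alternating descent of `π` iff it is one of `π'`.
(ii) If `i ∈ {1,...,n-1}` is a double descent of `σ` and the signs of `π(i)` and `π'(i)`
agree, then `i` is an alternating descent of `π` iff it is one of `π'`. -/
theorem stmt12 (n : ℕ) (σ : Equiv.Perm (Fin n)) (ε ε' : Fin n → Bool) :
    (∀ i (h2 : 2 ≤ i) (hin : i ≤ n),
      extA n σ (i - 1) < extA n σ i → extA n σ i < extA n σ (i + 1) →
      ε ⟨i - 1, by omega⟩ = ε' ⟨i - 1, by omega⟩ →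
      (isAltDesZ (wordB n σ ε) (i - 1) ↔ isAltDesZ (wordB n σ ε') (i - 1))) ∧
    (∀ i (h1 : 1 ≤ i) (hin : i < n),
      extA n σ i < extA n σ (i - 1) → extA n σ (i + 1) < extA n σ i →
      ε ⟨i - 1, by omega⟩ = ε' ⟨i - 1, by omega⟩ →
      (isAltDesZ (wordB n σ ε) i ↔ isAltDesZ (wordB n σ ε') i)) := by
  constructor
  · intro i h2 hin hlt _ hε
    obtain ⟨j, rfl⟩ : ∃ j, i = j + 1 := ⟨i - 1, by omega⟩
    have hw := wordB_congr_sign σ (by omega) hin hε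
    have ha := wordB_eq_or_eq_neg_extA σ ε (i := j + 1) (by omega) hin
    have hb := wordB_eq_or_eq_neg_extA σ ε (i := j) (by omega) (by omega)
    have hb' := wordB_eq_or_eq_neg_extA σ ε' (i := j) (by omega) (by omega)
    simp only [Nat.add_sub_cancel] at hlt ⊢
    apply isAltDesZ_congr <;> omega
  · intro i h1 hin _ hlt hε
    have hw := wordB_congr_sign σ h1 hin.le hε
    have ha := wordB_eq_or_eq_neg_extA σ ε h1 hin.le
    have hb := wordB_eq_or_eq_neg_extA σ ε (i := i + 1) (by omega) hin
    have hb' := wordB_eq_or_eq_neg_extA σ ε' (i := i + 1) (by omega) hin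
    apply isAltDesZ_congr <;> omega
end

section
/- Let σ be a permutation of {1,...,n} with boundary convention σ(0) = σ(n+1) = n+1, and let π = ε_1σ(1)···ε_nσ(n) and π' = ε_1'σ(1)···ε_n'σ(n) be two elements of Orb(σ) with ε_i = ε_i' for a fixed index i. (iii) If i is a peak of σ with 2 ≤ i ≤ n−1, then the set of alternating descents of π among {i−1, i} equals the set of alternating descents of π' among {i−1, i}, and this set is either {i−1, i} or empty. (iv) If i ∈ {1,...,n−1} is a valley of σ and the signs of π(i+1) and π'(i+1) agree, then i is an alternating descent of π if and only if i is an alternating descent of π'. -/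
open Finset

theorem extA_eq {n : ℕ} (σ : Equiv.Perm (Fin n)) {j : ℕ} (hj : j < n) :
    extA n σ (j + 1) = (σ ⟨j, hj⟩ : ℕ) + 1 := by
  have h : 1 ≤ j + 1 ∧ j + 1 ≤ n := by omega
  simp [extA, h]

theorem wordB_eq {n : ℕ} (σ : Equiv.Perm (Fin n)) (ε : Fin n → Bool) {j : ℕ} (hj : j < n) :
    wordB n σ ε (j + 1) = if ε ⟨j, hj⟩ then (extA n σ (j + 1) : ℤ) else -extA n σ (j + 1) := by
  have h : 1 ≤ j + 1 ∧ j + 1 ≤ n := by omega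
  simp [wordB, extA_eq σ hj, h]

/-- Comparing a signed letter with one of smaller absolute value only depends on its sign. -/
theorem wordB_lt_iff_s13 {n : ℕ} {σ : Equiv.Perm (Fin n)} (ε : Fin n → Bool) {j k : ℕ}
    (hj : j < n) (hk : k < n) (h : extA n σ (j + 1) < extA n σ (k + 1)) :
    wordB n σ ε (j + 1) < wordB n σ ε (k + 1) ↔ ε ⟨k, hk⟩ = true := by
  rw [wordB_eq σ ε hj, wordB_eq σ ε hk]
  by_cases h₁ : ε ⟨j, hj⟩ <;> by_cases h₂ : ε ⟨k, hk⟩ <;> simp [h₁, h₂] <;> omega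

/-- Comparing a signed letter with one of smaller absolute value only depends on its sign. -/
theorem lt_wordB_iff {n : ℕ} {σ : Equiv.Perm (Fin n)} (ε : Fin n → Bool) {j k : ℕ}
    (hj : j < n) (hk : k < n) (h : extA n σ (j + 1) < extA n σ (k + 1)) :
    wordB n σ ε (k + 1) < wordB n σ ε (j + 1) ↔ ¬ ε ⟨k, hk⟩ = true := by
  rw [wordB_eq σ ε hj, wordB_eq σ ε hk]
  by_cases h₁ : ε ⟨j, hj⟩ <;> by_cases h₂ : ε ⟨k, hk⟩ <;> simp [h₁, h₂] <;> omega

/-- At an ascent of absolute values, being an alternating descent is decided by the sign of the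
right letter. -/
theorem isAltDesZ_wordB_of_lt {n : ℕ} {σ : Equiv.Perm (Fin n)} (ε : Fin n → Bool) {j : ℕ}
    (hj : j + 1 < n) (h : extA n σ (j + 1) < extA n σ (j + 2)) :
    isAltDesZ (wordB n σ ε) (j + 1) ↔ (Even (j + 1) ↔ ε ⟨j + 1, hj⟩ = true) := by
  rw [isAltDesZ, wordB_lt_iff_s13 ε (by omega) hj h, lt_wordB_iff ε (by omega) hj h,
    ← Nat.not_even_iff_odd]
  tauto

/-- At a descent of absolute values, being an alternating descent is decided by the sign of the
left letter. -/
theorem isAltDesZ_wordB_of_gt {n : ℕ} {σ : Equiv.Perm (Fin n)} (ε : Fin n → Bool) {j : ℕ}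
    (hj : j + 1 < n) (h : extA n σ (j + 2) < extA n σ (j + 1)) :
    isAltDesZ (wordB n σ ε) (j + 1) ↔ (Odd (j + 1) ↔ ε ⟨j, by omega⟩ = true) := by
  rw [isAltDesZ, wordB_lt_iff_s13 ε hj (by omega) h, lt_wordB_iff ε hj (by omega) h,
    ← Nat.not_even_iff_odd]
  tauto

/-- Let `σ` be a permutation of `{1,...,n}` (boundary convention
`σ(0) = σ(n+1) = n+1`) and let `π, π' ∈ Orb(σ)` be given by sign vectors `ε, ε'`.
(iii) If `i` is a peak of `σ` with `2 ≤ i ≤ n-1` and the signs of `π(i)` and `π'(i)` agree,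
then the alternating descents of `π` among `{i-1, i}` coincide with those of `π'`, and this
set is either all of `{i-1, i}` or empty.
(iv) If `i ∈ {1,...,n-1}` is a valley of `σ` and the signs of `π(i+1)` and `π'(i+1)` agree,
then `i` is an alternating descent of `π` iff it is one of `π'`. -/
theorem stmt13 (n : ℕ) (σ : Equiv.Perm (Fin n)) (ε ε' : Fin n → Bool) :
    (∀ i (h2 : 2 ≤ i) (hin : i < n),
      extA n σ (i - 1) < extA n σ i → extA n σ (i + 1) < extA n σ i →
      ε ⟨i - 1, by omega⟩ = ε' ⟨i - 1, by omega⟩ →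
      ((isAltDesZ (wordB n σ ε) (i - 1) ↔ isAltDesZ (wordB n σ ε') (i - 1)) ∧
       (isAltDesZ (wordB n σ ε) i ↔ isAltDesZ (wordB n σ ε') i) ∧
       (isAltDesZ (wordB n σ ε) (i - 1) ↔ isAltDesZ (wordB n σ ε) i))) ∧
    (∀ i (h1 : 1 ≤ i) (hin : i < n),
      extA n σ i < extA n σ (i - 1) → extA n σ i < extA n σ (i + 1) →
      ε ⟨i, by omega⟩ = ε' ⟨i, by omega⟩ →
      (isAltDesZ (wordB n σ ε) i ↔ isAltDesZ (wordB n σ ε') i)) := by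
  constructor
  · intro i h2 hin hl hr hε
    obtain ⟨k, rfl⟩ := Nat.exists_eq_add_of_le' h2
    simp only [Nat.add_succ_sub_one] at hl hε ⊢
    rw [isAltDesZ_wordB_of_lt ε (by omega) hl, isAltDesZ_wordB_of_lt ε' (by omega) hl,
      isAltDesZ_wordB_of_gt ε hin hr, isAltDesZ_wordB_of_gt ε' hin hr, hε,
      Nat.odd_add_one (n := k + 1), Nat.not_odd_iff_even]
    simp
  · intro i h1 hin _ hr hε
    obtain ⟨k, rfl⟩ := Nat.exists_eq_add_of_le' h1
    rw [isAltDesZ_wordB_of_lt ε hin hr, isAltDesZ_wordB_of_lt ε' hin hr, hε]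
end
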